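/- Let d ≥ 1 be an integer, s ∈ (0,d), and let h be a measure function such that h(r)/r^d is nonincreasing and ∫_0^a (h(t)/t^s)² dt/t = ∞ for some (equivalently every) a > 0. Then there exists a compact set E ⊂ ℝ^d such that M_h(E) > 0 but γ_{s,+}(E) = 0. -/

import Mathlib

open MeasureTheory Filter Metric Set
open scoped ENNReal NNReal Topology

noncomputable section

/-- The `s`-Riesz kernel `K^s(x) = x / |x|^{s+1}` in `ℝᵈ`. -/
def rieszKernel (d : ℕ) (s : ℝ) (x : EuclideanSpace ℝ (Fin d)) : EuclideanSpace ℝ (Fin d) :=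
  ‖x‖ ^ (-(s + 1)) • x

/-- The `ε`-truncated `s`-Riesz transform of the measure `ν`. -/
def truncRiesz (d : ℕ) (s : ℝ) (ν : Measure (EuclideanSpace ℝ (Fin d))) (ε : ℝ)
    (x : EuclideanSpace ℝ (Fin d)) : EuclideanSpace ℝ (Fin d) :=
  ∫ y in {y | ε < dist y x}, rieszKernel d s (y - x) ∂ν

/-- Existence of the principal value `s`-Riesz transform of `ν` at `x`. -/
def rieszExists (d : ℕ) (s : ℝ) (ν : Measure (EuclideanSpace ℝ (Fin d)))
    (x : EuclideanSpace ℝ (Fin d)) : Prop :=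
  ∃ L, Tendsto (fun ε => truncRiesz d s ν ε x) (𝓝[>] (0 : ℝ)) (𝓝 L)

/-- The principal value `s`-Riesz transform of `ν` at `x` (junk value if the limit
does not exist). -/
def rieszTransform (d : ℕ) (s : ℝ) (ν : Measure (EuclideanSpace ℝ (Fin d)))
    (x : EuclideanSpace ℝ (Fin d)) : EuclideanSpace ℝ (Fin d) :=
  limUnder (𝓝[>] (0 : ℝ)) (fun ε => truncRiesz d s ν ε x)


/-- The capacity `γ_{s,+}(E)`: the supremum of total masses of positive measures
supported on `E` whose `s`-Riesz transform exists a.e. and is bounded by `1`. -/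
def gammaPlus (d : ℕ) (s : ℝ) (E : Set (EuclideanSpace ℝ (Fin d))) : ℝ :=
  sSup {t : ℝ | ∃ ν : Measure (EuclideanSpace ℝ (Fin d)), IsFiniteMeasure ν ∧
    ν Eᶜ = 0 ∧
    (∀ᵐ x : EuclideanSpace ℝ (Fin d), rieszExists d s ν x ∧ ‖rieszTransform d s ν x‖ ≤ 1) ∧
    t = (ν univ).toReal}

/-- The Hausdorff content `M_h(G)` associated with a gauge function `h`: the infimum of
`Σ_j h(r_j)` over all countable coverings of `G` by balls of radii `r_j`. -/
def hContent (d : ℕ) (h : ℝ → ℝ) (G : Set (EuclideanSpace ℝ (Fin d))) : ℝ≥0∞ :=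
  ⨅ (x : ℕ → EuclideanSpace ℝ (Fin d)) (r : ℕ → ℝ) (_ : ∀ j, 0 < r j)
    (_ : G ⊆ ⋃ j, closedBall (x j) (r j)), ∑' j, ENNReal.ofReal (h (r j))

section Kernel

variable {d : ℕ} {s : ℝ}

lemma rieszKernel_neg (v : EuclideanSpace ℝ (Fin d)) :
    rieszKernel d s (-v) = -rieszKernel d s v := by
  simp [rieszKernel]

lemma norm_rieszKernel {v : EuclideanSpace ℝ (Fin d)} (hv : v ≠ 0) :
    ‖rieszKernel d s v‖ = ‖v‖ ^ (-s) := by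
  have h : 0 < ‖v‖ := norm_pos_iff.2 hv
  rw [rieszKernel, norm_smul, Real.norm_of_nonneg (by positivity)]
  nth_rw 2 [← Real.rpow_one ‖v‖]
  rw [← Real.rpow_add h]
  congr 1
  ring

lemma norm_rieszKernel_le (hs : 0 < s) {ρ : ℝ} (hρ : 0 < ρ) {v : EuclideanSpace ℝ (Fin d)}
    (hv : ρ ≤ ‖v‖) : ‖rieszKernel d s v‖ ≤ ρ ^ (-s) := by
  rw [norm_rieszKernel (norm_pos_iff.1 (hρ.trans_le hv))]
  exact Real.rpow_le_rpow_of_nonpos hρ hv (by linarith)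

lemma rpow_neg_sub_le {q a b : ℝ} (hq : 0 < q) (hb : 0 < b) (hab : b ≤ a) :
    (b ^ (-q) - a ^ (-q)) * b ≤ q * b ^ (-q) * (a - b) := by
  have ha : 0 < a := hb.trans_le hab
  have h1 : a = b * (a / b) := by field_simp
  have ht : 0 < a / b := by positivity
  have h2 : 1 - q * (a / b - 1) ≤ (a / b) ^ (-q) := by
    have h3 := Real.log_le_sub_one_of_pos ht
    rw [Real.rpow_def_of_pos ht]
    have h4 := Real.add_one_le_exp (Real.log (a / b) * -q)
    nlinarith
  have h5 : a ^ (-q) = b ^ (-q) * (a / b) ^ (-q) := by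
    rw [← Real.mul_rpow hb.le ht.le, ← h1]
  have h6 : 0 < b ^ (-q) := by positivity
  have h7 : b ^ (-q) * (1 - q * (a / b - 1)) ≤ a ^ (-q) := by
    rw [h5]; gcongr
  have h8 : (a / b - 1) * b = a - b := by field_simp
  calc (b ^ (-q) - a ^ (-q)) * b
      ≤ (b ^ (-q) - b ^ (-q) * (1 - q * (a / b - 1))) * b := by gcongr
    _ = q * b ^ (-q) * ((a / b - 1) * b) := by ring
    _ = q * b ^ (-q) * (a - b) := by rw [h8]

lemma rieszKernel_sub_le (hs : 0 < s) {ρ : ℝ} (hρ : 0 < ρ) {a b : EuclideanSpace ℝ (Fin d)}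
    (ha : ρ ≤ ‖a‖) (hb : ρ ≤ ‖b‖) :
    ‖rieszKernel d s a - rieszKernel d s b‖ ≤ (s + 2) * ρ ^ (-(s + 1)) * ‖a - b‖ := by
  wlog hab : ‖b‖ ≤ ‖a‖ generalizing a b
  · rw [norm_sub_rev, norm_sub_rev a b]
    exact this hb ha (le_of_not_ge hab)
  have hb0 : 0 < ‖b‖ := hρ.trans_le hb
  have h1 : rieszKernel d s a - rieszKernel d s b =
      ‖a‖ ^ (-(s + 1)) • (a - b) - (‖b‖ ^ (-(s + 1)) - ‖a‖ ^ (-(s + 1))) • b := by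
    simp only [rieszKernel, smul_sub, sub_smul]
    abel
  have hmono : ‖a‖ ^ (-(s + 1)) ≤ ‖b‖ ^ (-(s + 1)) :=
    Real.rpow_le_rpow_of_nonpos hb0 hab (by linarith)
  have hmono2 : ‖b‖ ^ (-(s + 1)) ≤ ρ ^ (-(s + 1)) :=
    Real.rpow_le_rpow_of_nonpos hρ hb (by linarith)
  have h2 := rpow_neg_sub_le (q := s + 1) (by linarith) hb0 hab
  have h3 : ‖a‖ - ‖b‖ ≤ ‖a - b‖ := norm_sub_norm_le a b
  have h4 : 0 < ‖b‖ ^ (-(s + 1)) := by positivity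
  have h5 : 0 < ‖a‖ ^ (-(s + 1)) := Real.rpow_pos_of_pos (hb0.trans_le hab) _
  rw [h1]
  refine (norm_sub_le _ _).trans ?_
  rw [norm_smul, norm_smul, Real.norm_of_nonneg h5.le, Real.norm_of_nonneg (by linarith)]
  calc ‖a‖ ^ (-(s + 1)) * ‖a - b‖ + (‖b‖ ^ (-(s + 1)) - ‖a‖ ^ (-(s + 1))) * ‖b‖
      ≤ ρ ^ (-(s + 1)) * ‖a - b‖ + (s + 1) * ρ ^ (-(s + 1)) * ‖a - b‖ := by
        refine add_le_add
          (mul_le_mul_of_nonneg_right (hmono.trans hmono2) (norm_nonneg _)) (h2.trans ?_)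
        have h6 : 0 ≤ ‖a‖ - ‖b‖ := by linarith
        gcongr
    _ = _ := by ring

end Kernel

section UnitField

variable {V : Type*} [NormedAddCommGroup V] [InnerProductSpace ℝ V]

/-- The unit vector in the direction of `v` (zero for `v = 0`). -/
def unitVec (v : V) : V := ‖v‖⁻¹ • v

lemma norm_unitVec_le (v : V) : ‖unitVec v‖ ≤ 1 := by
  rw [unitVec, norm_smul, norm_inv, norm_norm]
  exact inv_mul_le_one

lemma inner_unitVec_sub (p q : V) :
    inner ℝ (p - q) (unitVec p - unitVec q) * (‖p‖ * ‖q‖) =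
      (‖p‖ + ‖q‖) * (‖p‖ * ‖q‖ - inner ℝ p q) := by
  by_cases hp : p = 0
  · simp [hp, unitVec]
  by_cases hq : q = 0
  · simp [hq, unitVec]
  have hp' : ‖p‖ ≠ 0 := norm_ne_zero_iff.2 hp
  have hq' : ‖q‖ ≠ 0 := norm_ne_zero_iff.2 hq
  simp only [unitVec, inner_sub_left, inner_sub_right, inner_smul_right,
    real_inner_self_eq_norm_sq, real_inner_comm p q]
  field_simp
  ring

lemma inner_unitVec_sub_zero_left (q : V) :
    inner ℝ (0 - q) (unitVec (0 : V) - unitVec q) = ‖q‖ := by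
  by_cases hq : q = 0
  · simp [hq]
  have hq' : ‖q‖ ≠ 0 := norm_ne_zero_iff.2 hq
  simp only [unitVec, smul_zero, zero_sub, inner_neg_neg, inner_smul_right,
    real_inner_self_eq_norm_sq]
  field_simp

lemma inner_unitVec_sub_zero_right (p : V) :
    inner ℝ (p - 0) (unitVec p - unitVec (0 : V)) = ‖p‖ := by
  have h := inner_unitVec_sub_zero_left p
  rw [← inner_neg_neg] at h
  simpa using h

lemma inner_unitVec_sub_nonneg (p q : V) :
    0 ≤ inner ℝ (p - q) (unitVec p - unitVec q) := by
  by_cases hp : p = 0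
  · subst hp; rw [inner_unitVec_sub_zero_left]; positivity
  by_cases hq : q = 0
  · subst hq; rw [inner_unitVec_sub_zero_right]; positivity
  have hp' : 0 < ‖p‖ := norm_pos_iff.2 hp
  have hq' : 0 < ‖q‖ := norm_pos_iff.2 hq
  have h := inner_unitVec_sub p q
  have h2 := real_inner_le_norm p q
  have h3 : 0 ≤ (‖p‖ + ‖q‖) * (‖p‖ * ‖q‖ - inner ℝ p q) :=
    mul_nonneg (by positivity) (by linarith)
  rw [← h] at h3
  exact nonneg_of_mul_nonneg_left h3 (by positivity)

lemma le_inner_unitVec_sub {p q : V} (hp : ‖p‖ ≤ ‖p - q‖) (hq : ‖q‖ ≤ ‖p - q‖) :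
    ‖p - q‖ / 2 ≤ inner ℝ (p - q) (unitVec p - unitVec q) := by
  by_cases hp0 : p = 0
  · subst hp0; rw [inner_unitVec_sub_zero_left, zero_sub, norm_neg]
    linarith [norm_nonneg q]
  by_cases hq0 : q = 0
  · subst hq0; rw [inner_unitVec_sub_zero_right, sub_zero]
    linarith [norm_nonneg p]
  have hp' : 0 < ‖p‖ := norm_pos_iff.2 hp0
  have hq' : 0 < ‖q‖ := norm_pos_iff.2 hq0
  have h := inner_unitVec_sub p q
  have h2 := norm_sub_sq_real p q
  have h3 : ‖p - q‖ ≤ ‖p‖ + ‖q‖ := norm_sub_le p q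
  have h4 : inner ℝ p q ≤ ‖p‖ * ‖q‖ / 2 := by
    rcases le_total ‖p‖ ‖q‖ with h5 | h5 <;> nlinarith
  have h5 : 0 < ‖p‖ * ‖q‖ := by positivity
  have h6 : ‖p - q‖ / 2 * (‖p‖ * ‖q‖) ≤
      inner ℝ (p - q) (unitVec p - unitVec q) * (‖p‖ * ‖q‖) := by
    rw [h]
    nlinarith
  exact le_of_mul_le_mul_right h6 h5

end UnitField

section Tree

open scoped Classical

variable {d : ℕ} {W : Type*}

/-- The digit strings of `w` and `w'` agree below level `j`. -/
def Agree (dig : ℕ → W → Fin d → ℤ) (j : ℕ) (w w' : W) : Prop :=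
  ∀ i < j, dig i w = dig i w'

variable {dig : ℕ → W → Fin d → ℤ} {j k : ℕ} {w v u : W}

lemma Agree.rfl : Agree dig j w w := fun _ _ => Eq.refl _

lemma Agree.symm (h : Agree dig j w v) : Agree dig j v w := fun i hi => (h i hi).symm

lemma Agree.trans (h : Agree dig j w v) (h' : Agree dig j v u) : Agree dig j w u :=
  fun i hi => (h i hi).trans (h' i hi)

lemma Agree.mono (h : Agree dig k w v) (hjk : j ≤ k) : Agree dig j w v :=
  fun i hi => h i (hi.trans_le hjk)

lemma agree_zero : Agree dig 0 w v := fun i hi => absurd hi (by omega)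

lemma agree_succ : Agree dig (j + 1) w v ↔ Agree dig j w v ∧ dig j w = dig j v := by
  constructor
  · exact fun h => ⟨h.mono (by omega), h j (by omega)⟩
  · rintro ⟨h, h'⟩ i hi
    rcases Nat.lt_succ_iff_lt_or_eq.1 hi with h1 | rfl
    · exact h i h1
    · exact h'

/-- The indicator of `Agree`. -/
def agreeInd (dig : ℕ → W → Fin d → ℤ) (j : ℕ) (w w' : W) : ℝ :=
  if Agree dig j w w' then 1 else 0

/-- The indicator of the pairs of strings whose first difference occurs at level `j`. -/
def branchInd (dig : ℕ → W → Fin d → ℤ) (j : ℕ) (w w' : W) : ℝ :=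
  if Agree dig j w w' ∧ dig j w ≠ dig j w' then 1 else 0

lemma agreeInd_of (h : Agree dig j w v) : agreeInd dig j w v = 1 := if_pos h

lemma agreeInd_of_not (h : ¬ Agree dig j w v) : agreeInd dig j w v = 0 := if_neg h

lemma agreeInd_nonneg : 0 ≤ agreeInd dig j w v := by
  unfold agreeInd; split_ifs <;> norm_num

lemma branchInd_nonneg : 0 ≤ branchInd dig j w v := by
  unfold branchInd; split_ifs <;> norm_num

lemma agreeInd_comm : agreeInd dig j w v = agreeInd dig j v w := by
  unfold agreeInd
  exact if_congr ⟨Agree.symm, Agree.symm⟩ rfl rfl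

lemma branchInd_comm : branchInd dig j w v = branchInd dig j v w := by
  unfold branchInd
  exact if_congr ⟨fun h => ⟨h.1.symm, h.2.symm⟩, fun h => ⟨h.1.symm, h.2.symm⟩⟩ rfl rfl

lemma agreeInd_congr (h : Agree dig j w v) : agreeInd dig j w u = agreeInd dig j v u := by
  unfold agreeInd
  exact if_congr ⟨h.symm.trans, h.trans⟩ rfl rfl

lemma branchInd_congr (h : Agree dig (j + 1) w v) :
    branchInd dig j w u = branchInd dig j v u := by
  have h' := agree_succ.1 h
  unfold branchInd
  rw [h'.2]
  exact if_congr (and_congr_left fun _ => ⟨h'.1.symm.trans, h'.1.trans⟩) rfl rfl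

lemma branchInd_eq_sub : branchInd dig j w v = agreeInd dig j w v - agreeInd dig (j + 1) w v := by
  unfold branchInd agreeInd
  simp only [agree_succ]
  by_cases h : Agree dig j w v <;> by_cases h' : dig j w = dig j v <;> simp [h, h']

/-- The reciprocal power of the distance of the `j`-th digits (zero when they coincide). -/
def digitWeight (dig : ℕ → W → Fin d → ℤ) (s : ℝ) (j : ℕ) (w w' : W) : ℝ :=
  ‖dig j w - dig j w'‖ ^ (-(s + 1))

variable {s : ℝ}

lemma digitWeight_nonneg : 0 ≤ digitWeight dig s j w v := by
  unfold digitWeight; positivity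

lemma digitWeight_comm : digitWeight dig s j w v = digitWeight dig s j v w := by
  unfold digitWeight; rw [norm_sub_rev]

variable [Fintype W]

/-- The mass of the level `j` class of `w`. -/
def classMass (dig : ℕ → W → Fin d → ℤ) (p : W → ℝ) (j : ℕ) (w : W) : ℝ :=
  ∑ w', agreeInd dig j w w' * p w'

/-- The digit-weighted mass of the level `j` class of `w`. -/
def classOsc (dig : ℕ → W → Fin d → ℤ) (s : ℝ) (p : W → ℝ) (j : ℕ) (w : W) : ℝ :=
  ∑ w', agreeInd dig j w w' * digitWeight dig s j w w' * p w'

variable {p : W → ℝ}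

lemma classMass_congr (h : Agree dig j w v) : classMass dig p j w = classMass dig p j v :=
  Finset.sum_congr rfl fun _ _ => by rw [agreeInd_congr h]

lemma classMass_nonneg (hp : ∀ w, 0 ≤ p w) : 0 ≤ classMass dig p j w :=
  Finset.sum_nonneg fun _ _ => mul_nonneg agreeInd_nonneg (hp _)

lemma le_classMass (hp : ∀ w, 0 ≤ p w) : p w ≤ classMass dig p j w := by
  have h := Finset.single_le_sum (f := fun w' => agreeInd dig j w w' * p w')
    (fun _ _ => mul_nonneg agreeInd_nonneg (hp _)) (Finset.mem_univ w)
  simpa [agreeInd_of (Agree.rfl (w := w)), classMass] using h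

lemma classOsc_nonneg (hp : ∀ w, 0 ≤ p w) : 0 ≤ classOsc dig s p j w :=
  Finset.sum_nonneg fun _ _ =>
    mul_nonneg (mul_nonneg agreeInd_nonneg digitWeight_nonneg) (hp _)

lemma sum_fiber_div_le_one (z : Fin d → ℤ) :
    ∑ w' with dig j w' = z, agreeInd dig j w w' * (p w' / classMass dig p (j + 1) w') ≤ 1 := by
  by_cases hz : ∃ v, Agree dig j w v ∧ dig j v = z
  · obtain ⟨v, hv, rfl⟩ := hz
    have : ∑ w' with dig j w' = dig j v,
        agreeInd dig j w w' * (p w' / classMass dig p (j + 1) w') =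
        (∑ w', agreeInd dig (j + 1) v w' * p w') / classMass dig p (j + 1) v := by
      rw [Finset.sum_filter, Finset.sum_div]
      refine Finset.sum_congr rfl fun w' _ => ?_
      rw [agreeInd_congr hv]
      by_cases h1 : Agree dig (j + 1) v w'
      · have h2 := agree_succ.1 h1
        rw [if_pos h2.2.symm, agreeInd_of h2.1, agreeInd_of h1, classMass_congr h1]
        ring
      · rw [agreeInd_of_not h1]
        by_cases h3 : dig j w' = dig j v
        · rw [if_pos h3, agreeInd_of_not (fun h => h1 (agree_succ.2 ⟨h, h3.symm⟩))]
          simp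
        · rw [if_neg h3]; simp
    rw [this]
    exact div_self_le_one _
  · rw [Finset.sum_eq_zero]
    · exact zero_le_one
    · intro w' hw'
      rw [agreeInd_of_not, zero_mul]
      exact fun h => hz ⟨w', h, (Finset.mem_filter.1 hw').2⟩

lemma sum_digitWeight_div_le {A : ℝ}
    (hA : ∑ z ∈ Finset.univ.image (dig j), ‖dig j w - z‖ ^ (-(s + 1)) ≤ A) :
    ∑ w', agreeInd dig j w w' * digitWeight dig s j w w' *
      (p w' / classMass dig p (j + 1) w') ≤ A := by
  refine le_trans ?_ hA
  rw [← Finset.sum_fiberwise_of_maps_to (s := Finset.univ) (g := dig j)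
    (fun w' _ => Finset.mem_image_of_mem _ (Finset.mem_univ w'))]
  refine Finset.sum_le_sum fun z _ => ?_
  calc _ = ‖dig j w - z‖ ^ (-(s + 1)) * ∑ w' with dig j w' = z,
        agreeInd dig j w w' * (p w' / classMass dig p (j + 1) w') := by
        rw [Finset.mul_sum]
        refine Finset.sum_congr rfl fun w' hw' => ?_
        rw [digitWeight, (Finset.mem_filter.1 hw').2]
        ring
    _ ≤ _ := mul_le_of_le_one_right (by positivity) (sum_fiber_div_le_one z)

lemma div_classMass_mul (hp : ∀ w, 0 ≤ p w) :
    p w / classMass dig p j w * classMass dig p j w = p w := by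
  refine div_mul_cancel_of_imp fun h => ?_
  exact le_antisymm (h ▸ le_classMass hp) (hp w)

lemma classOsc_le (hp : ∀ w, 0 ≤ p w) {A M : ℝ}
    (hA : ∑ z ∈ Finset.univ.image (dig j), ‖dig j w - z‖ ^ (-(s + 1)) ≤ A)
    (hM : ∀ w', classMass dig p (j + 1) w' ≤ M) :
    classOsc dig s p j w ≤ A * M := by
  have hM0 : 0 ≤ M := (classMass_nonneg hp).trans (hM w)
  refine le_trans ?_ (mul_le_mul_of_nonneg_right
    (sum_digitWeight_div_le (p := p) hA) hM0)
  rw [classOsc, Finset.sum_mul]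
  refine Finset.sum_le_sum fun w' _ => ?_
  have h0 : 0 ≤ agreeInd dig j w w' * digitWeight dig s j w w' :=
    mul_nonneg agreeInd_nonneg digitWeight_nonneg
  have h1 : 0 ≤ p w' / classMass dig p (j + 1) w' := div_nonneg (hp _) (classMass_nonneg hp)
  rw [mul_assoc _ (p w' / _) M]
  refine mul_le_mul_of_nonneg_left ?_ h0
  conv_lhs => rw [← div_classMass_mul (dig := dig) (j := j + 1) (w := w') hp]
  exact mul_le_mul_of_nonneg_left (hM w') h1

lemma sum_mul_classOsc_sq_le (hp : ∀ w, 0 ≤ p w) {A : ℝ}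
    (hA : ∀ w, ∑ z ∈ Finset.univ.image (dig j), ‖dig j w - z‖ ^ (-(s + 1)) ≤ A) :
    ∑ w, p w * classOsc dig s p j w ^ 2 ≤
      A ^ 2 * ∑ w, p w * classMass dig p (j + 1) w ^ 2 := by
  set X := ∑ w, p w * classOsc dig s p j w ^ 2
  set Y := ∑ w, p w * (classMass dig p (j + 1) w * classOsc dig s p j w)
  set α := ∑ w, p w * classMass dig p (j + 1) w ^ 2
  have hα : 0 ≤ α := Finset.sum_nonneg fun w _ => mul_nonneg (hp w) (sq_nonneg _)
  have hX : 0 ≤ X := Finset.sum_nonneg fun w _ => mul_nonneg (hp w) (sq_nonneg _)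
  have hY : 0 ≤ Y := Finset.sum_nonneg fun w _ =>
    mul_nonneg (hp w) (mul_nonneg (classMass_nonneg hp) (classOsc_nonneg hp))
  have h1 : ∀ w, classOsc dig s p j w ^ 2 ≤ A * ∑ w', agreeInd dig j w w' *
      digitWeight dig s j w w' * (p w' * classMass dig p (j + 1) w') := by
    intro w
    have hk : ∀ w', 0 ≤ agreeInd dig j w w' * digitWeight dig s j w w' :=
      fun w' => mul_nonneg agreeInd_nonneg digitWeight_nonneg
    refine (Finset.sum_sq_le_sum_mul_sum_of_sq_le_mul Finset.univ
      (f := fun w' => agreeInd dig j w w' * digitWeight dig s j w w' *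
        (p w' / classMass dig p (j + 1) w'))
      (g := fun w' => agreeInd dig j w w' * digitWeight dig s j w w' *
        (p w' * classMass dig p (j + 1) w')) (fun w' _ => mul_nonneg (hk w')
        (div_nonneg (hp _) (classMass_nonneg hp))) (fun w' _ => mul_nonneg (hk w')
        (mul_nonneg (hp _) (classMass_nonneg hp))) (fun w' _ => ?_)).trans ?_
    · have := div_classMass_mul (dig := dig) (j := j + 1) (w := w') hp
      refine le_of_eq ?_
      linear_combination (-(agreeInd dig j w w' * digitWeight dig s j w w') ^ 2 * p w') * this
    · exact mul_le_mul_of_nonneg_right (sum_digitWeight_div_le (hA w))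
        (Finset.sum_nonneg fun w' _ => mul_nonneg (hk w')
          (mul_nonneg (hp _) (classMass_nonneg hp)))
  have h2 : X ≤ A * Y := by
    calc X ≤ ∑ w, p w * (A * ∑ w', agreeInd dig j w w' *
          digitWeight dig s j w w' * (p w' * classMass dig p (j + 1) w')) :=
          Finset.sum_le_sum fun w _ => mul_le_mul_of_nonneg_left (h1 w) (hp w)
      _ = A * Y := by
          simp only [Y, Finset.mul_sum, classOsc]
          rw [Finset.sum_comm]
          refine Finset.sum_congr rfl fun w _ => Finset.sum_congr rfl fun w' _ => ?_
          rw [agreeInd_comm (w := w) (v := w'), digitWeight_comm (w := w) (v := w')]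
          ring
  have h3 : Y ^ 2 ≤ α * X := by
    refine Finset.sum_sq_le_sum_mul_sum_of_sq_le_mul Finset.univ
      (fun w _ => mul_nonneg (hp w) (sq_nonneg _))
      (fun w _ => mul_nonneg (hp w) (sq_nonneg _)) (fun w _ => le_of_eq ?_)
    ring
  rcases hX.eq_or_lt with h0 | h0
  · rw [← h0]; positivity
  · have h4 : X ^ 2 ≤ A ^ 2 * (α * X) := by
      calc X ^ 2 ≤ (A * Y) ^ 2 := by gcongr
        _ = A ^ 2 * Y ^ 2 := by ring
        _ ≤ _ := by gcongr
    have h5 : X * X ≤ (A ^ 2 * α) * X := by nlinarith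
    exact le_of_mul_le_mul_right h5 h0

end Tree

section Energy

open scoped Classical

/-- A finite family of points indexed by digit strings, with the separation and diameter
estimates of a Cantor construction. -/
structure DigitTree (d : ℕ) (s : ℝ) (W : Type*) [Fintype W] where
  /-- The digits of an index. -/
  dig : ℕ → W → Fin d → ℤ
  /-- The point attached to an index. -/
  pos : W → EuclideanSpace ℝ (Fin d)
  /-- The side length at each level. -/
  len : ℕ → ℝ
  /-- The separation at each level. -/
  gap : ℕ → ℝ
  /-- The ratio of diameter and side length. -/
  diam : ℝ
  /-- A bound for the digit sums at each level. -/
  digitSum : ℕ → ℝ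
  len_pos : ∀ j, 0 < len j
  gap_pos : ∀ j, 0 < gap j
  diam_pos : 0 < diam
  norm_le : ∀ j w w', Agree dig j w w' → ‖pos w - pos w'‖ ≤ diam * len j
  le_norm : ∀ j w w', Agree dig j w w' → gap j * ‖dig j w - dig j w'‖ ≤ ‖pos w - pos w'‖
  sum_le : ∀ j w, ∑ z ∈ Finset.univ.image (dig j), ‖dig j w - z‖ ^ (-(s + 1)) ≤ digitSum j
  diam_le_gap : ∀ j, diam * len (j + 1) ≤ gap j

variable {d : ℕ} {s : ℝ} {W : Type*} [Fintype W] (T : DigitTree d s W) (p : W → ℝ)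

namespace DigitTree

/-- The part of the Riesz transform at `w` that comes from the strings branching off
at level `j`. -/
def field (j : ℕ) (w : W) : EuclideanSpace ℝ (Fin d) :=
  ∑ w', (branchInd T.dig j w w' * p w') • rieszKernel d s (T.pos w - T.pos w')

/-- The sum of the cubes of the masses of the level `j` classes. -/
def cubeSum (j : ℕ) : ℝ := ∑ w, p w * classMass T.dig p j w ^ 2

/-- The energy of the level `j` field. -/
def energy (j : ℕ) : ℝ := ∑ w, p w * ‖T.field p j w‖ ^ 2

variable {T p} {j k : ℕ} {w v : W}

lemma digitSum_nonneg (T : DigitTree d s W) [Nonempty W] (j : ℕ) : 0 ≤ T.digitSum j :=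
  le_trans (Finset.sum_nonneg fun _ _ => by positivity) (T.sum_le j (Classical.arbitrary W))

lemma cubeSum_nonneg (hp : ∀ w, 0 ≤ p w) : 0 ≤ T.cubeSum p j :=
  Finset.sum_nonneg fun w _ => mul_nonneg (hp w) (sq_nonneg _)

lemma energy_nonneg (hp : ∀ w, 0 ≤ p w) : 0 ≤ T.energy p j :=
  Finset.sum_nonneg fun w _ => mul_nonneg (hp w) (sq_nonneg _)

lemma one_le_norm_sub {a b : Fin d → ℤ} (h : a ≠ b) : (1 : ℝ) ≤ ‖a - b‖ := by
  obtain ⟨i, hi⟩ := Function.ne_iff.1 h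
  refine le_trans ?_ (norm_le_pi_norm (a - b) i)
  rw [Pi.sub_apply, Int.norm_eq_abs]
  exact_mod_cast Int.one_le_abs (sub_ne_zero.2 hi)

lemma norm_field_sub_le (hs : 0 < s) (hp : ∀ w, 0 ≤ p w) (hjk : j < k)
    (hwv : Agree T.dig k w v) :
    ‖T.field p j w - T.field p j v‖ ≤ (s + 2) * T.diam * T.len k * T.gap j ^ (-(s + 1)) *
      classOsc T.dig s p j w := by
  have hwv' : Agree T.dig (j + 1) w v := hwv.mono hjk
  have hd := T.norm_le k w v hwv
  rw [field, field, ← Finset.sum_sub_distrib, classOsc, Finset.mul_sum]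
  refine (norm_sum_le _ _).trans (Finset.sum_le_sum fun w' _ => ?_)
  rw [← branchInd_congr hwv', ← smul_sub, norm_smul,
    Real.norm_of_nonneg (mul_nonneg branchInd_nonneg (hp _))]
  by_cases hb : Agree T.dig j w w' ∧ T.dig j w ≠ T.dig j w'
  · have hz := one_le_norm_sub hb.2
    have hg := T.gap_pos j
    have hρ : 0 < T.gap j * ‖T.dig j w - T.dig j w'‖ := by positivity
    have h1 := T.le_norm j w w' hb.1
    have h2 := T.le_norm j v w' ((hwv'.mono (by omega)).symm.trans hb.1)
    rw [← (agree_succ.1 hwv').2] at h2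
    have h3 := rieszKernel_sub_le hs hρ h1 h2
    rw [sub_sub_sub_cancel_right, Real.mul_rpow hg.le (norm_nonneg _)] at h3
    have h4 : branchInd T.dig j w w' = 1 := if_pos hb
    rw [h4, agreeInd_of hb.1, digitWeight]
    have h5 := hp w'
    calc 1 * p w' * ‖rieszKernel d s (T.pos w - T.pos w') - rieszKernel d s (T.pos v - T.pos w')‖
        ≤ 1 * p w' * ((s + 2) * (T.gap j ^ (-(s + 1)) * ‖T.dig j w - T.dig j w'‖ ^ (-(s + 1))) *
          (T.diam * T.len k)) := by
          refine mul_le_mul_of_nonneg_left (h3.trans ?_) (by linarith)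
          exact mul_le_mul_of_nonneg_left hd (by positivity)
      _ = _ := by ring
  · have h4 : branchInd T.dig j w w' = 0 := if_neg hb
    rw [h4]
    have := T.len_pos k
    have := T.gap_pos j
    have := T.diam_pos
    have := mul_nonneg (mul_nonneg (agreeInd_nonneg (dig := T.dig) (j := j) (w := w) (v := w'))
      (digitWeight_nonneg (dig := T.dig) (s := s) (j := j) (w := w) (v := w'))) (hp w')
    simp only [zero_mul]
    positivity

lemma sum_inner_field (f : W → EuclideanSpace ℝ (Fin d)) :
    2 * ∑ w, p w * inner ℝ (f w) (T.field p k w) =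
      ∑ w, ∑ w', p w * p w' * branchInd T.dig k w w' *
        inner ℝ (f w - f w') (rieszKernel d s (T.pos w - T.pos w')) := by
  have h1 : ∑ w, p w * inner ℝ (f w) (T.field p k w) =
      ∑ w, ∑ w', p w * p w' * branchInd T.dig k w w' *
        inner ℝ (f w) (rieszKernel d s (T.pos w - T.pos w')) := by
    refine Finset.sum_congr rfl fun w _ => ?_
    rw [field, inner_sum, Finset.mul_sum]
    refine Finset.sum_congr rfl fun w' _ => ?_
    rw [inner_smul_right]
    ring
  have h2 : ∑ w, p w * inner ℝ (f w) (T.field p k w) =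
      ∑ w, ∑ w', p w * p w' * branchInd T.dig k w w' *
        inner ℝ (-f w') (rieszKernel d s (T.pos w - T.pos w')) := by
    rw [h1, Finset.sum_comm]
    refine Finset.sum_congr rfl fun w _ => Finset.sum_congr rfl fun w' _ => ?_
    rw [← neg_sub (T.pos w), rieszKernel_neg, branchInd_comm, inner_neg_right, inner_neg_left]
    ring
  rw [two_mul]
  nth_rw 1 [h1]
  rw [h2, ← Finset.sum_add_distrib]
  refine Finset.sum_congr rfl fun w _ => ?_
  rw [← Finset.sum_add_distrib]
  refine Finset.sum_congr rfl fun w' _ => ?_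
  rw [← mul_add, ← inner_add_left, ← sub_eq_add_neg]

lemma sum_inner_field_eq_zero {f : W → EuclideanSpace ℝ (Fin d)}
    (hf : ∀ w v, Agree T.dig k w v → f w = f v) :
    ∑ w, p w * inner ℝ (f w) (T.field p k w) = 0 := by
  have h := sum_inner_field (T := T) (p := p) (k := k) f
  suffices h0 : ∑ w, ∑ w', p w * p w' * branchInd T.dig k w w' *
      inner ℝ (f w - f w') (rieszKernel d s (T.pos w - T.pos w')) = 0 by
    linarith
  refine Finset.sum_eq_zero fun w _ => Finset.sum_eq_zero fun w' _ => ?_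
  by_cases hb : Agree T.dig k w w' ∧ T.dig k w ≠ T.dig k w'
  · rw [hf w w' hb.1]; simp
  · have h4 : branchInd T.dig k w w' = 0 := if_neg hb
    rw [h4]; simp

lemma exists_rep (T : DigitTree d s W) (k : ℕ) : ∃ rep : W → W,
    (∀ w, Agree T.dig k w (rep w)) ∧ ∀ w v, Agree T.dig k w v → rep w = rep v := by
  let S : Setoid W := ⟨Agree T.dig k, fun _ => Agree.rfl, Agree.symm, Agree.trans⟩
  refine ⟨fun w => (Quotient.mk S w).out, fun w => ?_, fun w v h => ?_⟩
  · exact (Quotient.exact (s := S) (Quotient.out_eq (Quotient.mk S w))).symm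
  · exact congrArg Quotient.out (Quotient.sound (s := S) h)

lemma abs_sum_inner_field_le (hs : 0 < s) (hp : ∀ w, 0 ≤ p w) (hjk : j < k) {δ : ℝ} (hδ : 0 < δ)
    (h : (s + 2) * T.diam * T.len k * T.gap j ^ (-(s + 1)) * T.digitSum j ≤
      δ * T.len (j + 1) ^ (-s)) :
    2 * |∑ w, p w * inner ℝ (T.field p j w) (T.field p k w)| ≤
      δ * (T.len (j + 1) ^ (-(2 * s)) * T.cubeSum p (j + 1) + T.energy p k) := by
  rcases isEmpty_or_nonempty W with hW | hW
  · simp [cubeSum, energy]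
  obtain ⟨rep, hrep, hrep'⟩ := exists_rep T k
  set c := (s + 2) * T.diam * T.len k * T.gap j ^ (-(s + 1)) with hc
  have hc0 : 0 ≤ c := by
    have := T.len_pos k
    have := T.gap_pos j
    have := T.diam_pos
    positivity
  have h1 : ∑ w, p w * inner ℝ (T.field p j w) (T.field p k w) =
      ∑ w, p w * inner ℝ (T.field p j w - T.field p j (rep w)) (T.field p k w) := by
    have h2 := sum_inner_field_eq_zero (T := T) (p := p) (k := k)
      (f := fun w => T.field p j (rep w)) (fun w v h => by rw [hrep' w v h])
    simp only [inner_sub_left, mul_sub, Finset.sum_sub_distrib, h2, sub_zero]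
  have h3 : ∀ w, 2 * (p w * |inner ℝ (T.field p j w - T.field p j (rep w)) (T.field p k w)|) ≤
      δ⁻¹ * c ^ 2 * (p w * classOsc T.dig s p j w ^ 2) + δ * (p w * ‖T.field p k w‖ ^ 2) := by
    intro w
    have h4 := norm_field_sub_le hs hp hjk (hrep w)
    have h5 := abs_real_inner_le_norm (T.field p j w - T.field p j (rep w)) (T.field p k w)
    have h6 : |inner ℝ (T.field p j w - T.field p j (rep w)) (T.field p k w)| ≤
        c * classOsc T.dig s p j w * ‖T.field p k w‖ :=
      h5.trans (mul_le_mul_of_nonneg_right h4 (norm_nonneg _))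
    have h7 : 2 * (c * classOsc T.dig s p j w * ‖T.field p k w‖) ≤
        δ⁻¹ * (c * classOsc T.dig s p j w) ^ 2 + δ * ‖T.field p k w‖ ^ 2 := by
      have h8 := mul_nonneg (inv_nonneg.2 hδ.le)
        (sq_nonneg (c * classOsc T.dig s p j w - δ * ‖T.field p k w‖))
      have h9 : δ⁻¹ * δ = 1 := inv_mul_cancel₀ hδ.ne'
      have : δ⁻¹ * (c * classOsc T.dig s p j w - δ * ‖T.field p k w‖) ^ 2 =
          δ⁻¹ * (c * classOsc T.dig s p j w) ^ 2 + (δ⁻¹ * δ) * δ * ‖T.field p k w‖ ^ 2 -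
          2 * (δ⁻¹ * δ) * (c * classOsc T.dig s p j w * ‖T.field p k w‖) := by ring
      rw [this, h9] at h8
      linarith
    nlinarith [hp w, mul_le_mul_of_nonneg_left h6 (hp w), mul_le_mul_of_nonneg_left h7 (hp w)]
  have h10 := sum_mul_classOsc_sq_le hp (T.sum_le j)
  have hl := T.len_pos (j + 1)
  have h11 : δ⁻¹ * c ^ 2 * T.digitSum j ^ 2 ≤ δ * T.len (j + 1) ^ (-(2 * s)) := by
    have h12 : (c * T.digitSum j) ^ 2 ≤ (δ * T.len (j + 1) ^ (-s)) ^ 2 := by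
      have := mul_nonneg hc0 (T.digitSum_nonneg j)
      gcongr
    have h13 : T.len (j + 1) ^ (-(2 * s)) = (T.len (j + 1) ^ (-s)) ^ 2 := by
      rw [← Real.rpow_natCast, ← Real.rpow_mul hl.le]
      congr 1; push_cast; ring
    rw [h13]
    calc δ⁻¹ * c ^ 2 * T.digitSum j ^ 2 = δ⁻¹ * (c * T.digitSum j) ^ 2 := by ring
      _ ≤ δ⁻¹ * (δ * T.len (j + 1) ^ (-s)) ^ 2 := by gcongr
      _ = (δ⁻¹ * δ) * δ * (T.len (j + 1) ^ (-s)) ^ 2 := by ring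
      _ = _ := by rw [inv_mul_cancel₀ hδ.ne', one_mul]
  rw [h1]
  calc 2 * |∑ w, p w * inner ℝ (T.field p j w - T.field p j (rep w)) (T.field p k w)|
      ≤ ∑ w, 2 * (p w * |inner ℝ (T.field p j w - T.field p j (rep w)) (T.field p k w)|) := by
        rw [← Finset.mul_sum]
        refine mul_le_mul_of_nonneg_left ((Finset.abs_sum_le_sum_abs _ _).trans ?_) (by norm_num)
        refine Finset.sum_le_sum fun w _ => ?_
        rw [abs_mul, abs_of_nonneg (hp w)]
    _ ≤ ∑ w, (δ⁻¹ * c ^ 2 * (p w * classOsc T.dig s p j w ^ 2) +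
          δ * (p w * ‖T.field p k w‖ ^ 2)) := Finset.sum_le_sum fun w _ => h3 w
    _ = δ⁻¹ * c ^ 2 * ∑ w, p w * classOsc T.dig s p j w ^ 2 + δ * T.energy p k := by
        rw [Finset.sum_add_distrib, ← Finset.mul_sum, ← Finset.mul_sum, energy]
    _ ≤ δ⁻¹ * c ^ 2 * (T.digitSum j ^ 2 * T.cubeSum p (j + 1)) + δ * T.energy p k := by
        have : 0 ≤ δ⁻¹ * c ^ 2 := by positivity
        exact add_le_add_left (mul_le_mul_of_nonneg_left h10 this) _
    _ = δ⁻¹ * c ^ 2 * T.digitSum j ^ 2 * T.cubeSum p (j + 1) + δ * T.energy p k := by ring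
    _ ≤ δ * T.len (j + 1) ^ (-(2 * s)) * T.cubeSum p (j + 1) + δ * T.energy p k :=
        add_le_add_left (mul_le_mul_of_nonneg_right h11 (cubeSum_nonneg hp)) _
    _ = _ := by ring

end DigitTree

end Energy

section EnergyBound

open scoped Classical

variable {d : ℕ} {s : ℝ} {W : Type*} [Fintype W] {T : DigitTree d s W} {p : W → ℝ}

namespace DigitTree

variable {j k : ℕ} {w v : W}

/-- The average of the unit vectors pointing from the level `j` class of `w` to `w`. -/
def unitField (T : DigitTree d s W) (p : W → ℝ) (j : ℕ) (w : W) : EuclideanSpace ℝ (Fin d) :=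
  ∑ z, (agreeInd T.dig j w z * p z) • unitVec (T.pos w - T.pos z)

/-- The pairing of kernel and unit field for a triple of points. -/
def triple (T : DigitTree d s W) (j : ℕ) (x y z : W) : ℝ :=
  branchInd T.dig j x y * agreeInd T.dig j x z *
    inner ℝ (unitVec (T.pos x - T.pos z) - unitVec (T.pos y - T.pos z))
      (rieszKernel d s (T.pos x - T.pos y))

lemma norm_unitField_le (hp : ∀ w, 0 ≤ p w) :
    ‖T.unitField p j w‖ ≤ classMass T.dig p j w := by
  refine (norm_sum_le _ _).trans (Finset.sum_le_sum fun z _ => ?_)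
  have h := mul_nonneg (agreeInd_nonneg (dig := T.dig) (j := j) (w := w) (v := z)) (hp z)
  rw [norm_smul, Real.norm_of_nonneg h]
  exact mul_le_of_le_one_right h (norm_unitVec_le _)

lemma sum_inner_field_unitField :
    2 * ∑ w, p w * inner ℝ (T.unitField p j w) (T.field p j w) =
      ∑ x, ∑ y, ∑ z, p x * p y * p z * T.triple j x y z := by
  rw [sum_inner_field]
  refine Finset.sum_congr rfl fun x _ => Finset.sum_congr rfl fun y _ => ?_
  by_cases hb : Agree T.dig j x y ∧ T.dig j x ≠ T.dig j y
  · have h : T.unitField p j x - T.unitField p j y = ∑ z, (agreeInd T.dig j x z * p z) •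
        (unitVec (T.pos x - T.pos z) - unitVec (T.pos y - T.pos z)) := by
      rw [unitField, unitField, ← Finset.sum_sub_distrib]
      refine Finset.sum_congr rfl fun z _ => ?_
      rw [← agreeInd_congr hb.1, smul_sub]
    rw [h, sum_inner, Finset.mul_sum]
    refine Finset.sum_congr rfl fun z _ => ?_
    rw [real_inner_smul_left, triple]
    ring
  · have h4 : branchInd T.dig j x y = 0 := if_neg hb
    simp [triple, h4]

lemma inner_unitVec_rieszKernel (a b c : EuclideanSpace ℝ (Fin d)) :
    inner ℝ (unitVec (a - c) - unitVec (b - c)) (rieszKernel d s (a - b)) =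
      ‖a - b‖ ^ (-(s + 1)) *
        inner ℝ ((a - c) - (b - c)) (unitVec (a - c) - unitVec (b - c)) := by
  rw [rieszKernel, inner_smul_right, real_inner_comm, sub_sub_sub_cancel_right]

lemma triple_nonneg (x y z : W) : 0 ≤ T.triple j x y z := by
  rw [triple, inner_unitVec_rieszKernel]
  exact mul_nonneg (mul_nonneg branchInd_nonneg agreeInd_nonneg)
    (mul_nonneg (by positivity) (inner_unitVec_sub_nonneg _ _))

lemma le_triple (hs : 0 < s) {x y z : W} (hxy : Agree T.dig j x y) (hxz : Agree T.dig j x z)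
    (hne : T.dig j x ≠ T.dig j y) (h1 : ‖T.pos x - T.pos z‖ ≤ ‖T.pos x - T.pos y‖)
    (h2 : ‖T.pos y - T.pos z‖ ≤ ‖T.pos x - T.pos y‖) :
    (T.diam * T.len j) ^ (-s) / 2 ≤ T.triple j x y z := by
  have hb : branchInd T.dig j x y = 1 := if_pos ⟨hxy, hne⟩
  have hpos : 0 < ‖T.pos x - T.pos y‖ :=
    (mul_pos (T.gap_pos j) (zero_lt_one.trans_le (one_le_norm_sub hne))).trans_le
      (T.le_norm j x y hxy)
  rw [triple, inner_unitVec_rieszKernel, hb, agreeInd_of hxz, one_mul, one_mul]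
  have h3 := le_inner_unitVec_sub (p := T.pos x - T.pos z) (q := T.pos y - T.pos z)
  rw [sub_sub_sub_cancel_right] at h3 ⊢
  have h4 : ‖T.pos x - T.pos y‖ ^ (-(s + 1)) * ‖T.pos x - T.pos y‖ =
      ‖T.pos x - T.pos y‖ ^ (-s) := by
    nth_rw 2 [← Real.rpow_one ‖T.pos x - T.pos y‖]
    rw [← Real.rpow_add hpos]
    congr 1; ring
  calc (T.diam * T.len j) ^ (-s) / 2 ≤ ‖T.pos x - T.pos y‖ ^ (-s) / 2 := by
        have := Real.rpow_le_rpow_of_nonpos hpos (T.norm_le j x y hxy) (z := -s) (by linarith)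
        linarith
    _ = ‖T.pos x - T.pos y‖ ^ (-(s + 1)) * (‖T.pos x - T.pos y‖ / 2) := by
        rw [← h4]; ring
    _ ≤ _ := mul_le_mul_of_nonneg_left (h3 h1 h2) (by positivity)

lemma norm_sub_le_of_branch {a b x y : W} (hab : Agree T.dig (j + 1) a b)
    (hxy : Agree T.dig j x y) (hne : T.dig j x ≠ T.dig j y) :
    ‖T.pos a - T.pos b‖ ≤ ‖T.pos x - T.pos y‖ :=
  calc ‖T.pos a - T.pos b‖ ≤ T.gap j := (T.norm_le _ a b hab).trans (T.diam_le_gap j)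
    _ ≤ T.gap j * ‖T.dig j x - T.dig j y‖ :=
        le_mul_of_one_le_right (T.gap_pos j).le (one_le_norm_sub hne)
    _ ≤ _ := T.le_norm j x y hxy

lemma le_triple_add_triple (hs : 0 < s) {x y z : W} (hxy : Agree T.dig j x y)
    (hxz : Agree T.dig j x z) (hne : ¬ (T.dig j x = T.dig j y ∧ T.dig j x = T.dig j z))
    (h1 : ‖T.pos x - T.pos z‖ ≤ ‖T.pos x - T.pos y‖)
    (h2 : ‖T.pos y - T.pos z‖ ≤ ‖T.pos x - T.pos y‖) :
    (T.diam * T.len j) ^ (-s) / 2 ≤ T.triple j x y z + T.triple j y z x := by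
  by_cases h : T.dig j x = T.dig j y
  · have hyz : T.dig j y ≠ T.dig j z := fun h' => hne ⟨h, h.trans h'⟩
    have h3 := norm_sub_le_of_branch (agree_succ.2 ⟨hxy, h⟩) (hxy.symm.trans hxz) hyz
    have h4 := le_triple hs (hxy.symm.trans hxz) hxy.symm hyz (by rwa [norm_sub_rev])
      (by rw [norm_sub_rev]; exact h1.trans h3)
    linarith [triple_nonneg (T := T) (j := j) x y z]
  · linarith [le_triple hs hxy hxz h h1 h2, triple_nonneg (T := T) (j := j) y z x]

lemma le_triple_cyclic (hs : 0 < s) (x y z : W) :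
    (T.diam * T.len j) ^ (-s) / 2 *
      (agreeInd T.dig j x y * agreeInd T.dig j x z -
        agreeInd T.dig (j + 1) x y * agreeInd T.dig (j + 1) x z) ≤
      T.triple j x y z + T.triple j y z x + T.triple j z x y := by
  have hc : 0 < (T.diam * T.len j) ^ (-s) / 2 := by
    have := mul_pos T.diam_pos (T.len_pos j)
    positivity
  have g1 := triple_nonneg (T := T) (j := j) x y z
  have g2 := triple_nonneg (T := T) (j := j) y z x
  have g3 := triple_nonneg (T := T) (j := j) z x y
  by_cases h : Agree T.dig j x y ∧ Agree T.dig j x z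
  · obtain ⟨hxy, hxz⟩ := h
    by_cases hne : T.dig j x = T.dig j y ∧ T.dig j x = T.dig j z
    · rw [agreeInd_of hxy, agreeInd_of hxz, agreeInd_of (agree_succ.2 ⟨hxy, hne.1⟩),
        agreeInd_of (agree_succ.2 ⟨hxz, hne.2⟩), sub_self, mul_zero]
      positivity
    · have hle : (T.diam * T.len j) ^ (-s) / 2 *
          (agreeInd T.dig j x y * agreeInd T.dig j x z -
          agreeInd T.dig (j + 1) x y * agreeInd T.dig (j + 1) x z) ≤
          (T.diam * T.len j) ^ (-s) / 2 := by
        rw [agreeInd_of hxy, agreeInd_of hxz]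
        refine mul_le_of_le_one_right hc.le ?_
        have := mul_nonneg (agreeInd_nonneg (dig := T.dig) (j := j + 1) (w := x) (v := y))
          (agreeInd_nonneg (dig := T.dig) (j := j + 1) (w := x) (v := z))
        linarith
      refine hle.trans ?_
      have e1 := norm_sub_rev (T.pos x) (T.pos y)
      have e2 := norm_sub_rev (T.pos x) (T.pos z)
      have e3 := norm_sub_rev (T.pos y) (T.pos z)
      rcases le_total ‖T.pos x - T.pos z‖ ‖T.pos x - T.pos y‖ with h1 | h1
      · rcases le_total ‖T.pos y - T.pos z‖ ‖T.pos x - T.pos y‖ with h2 | h2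
        · linarith [le_triple_add_triple hs hxy hxz hne h1 h2]
        · have := le_triple_add_triple (T := T) (j := j) hs (hxy.symm.trans hxz) hxy.symm
            (fun h => hne ⟨h.2.symm, h.2.symm.trans h.1⟩) (by linarith) (by linarith)
          linarith
      · rcases le_total ‖T.pos y - T.pos z‖ ‖T.pos x - T.pos z‖ with h2 | h2
        · have := le_triple_add_triple (T := T) (j := j) hs hxz.symm (hxz.symm.trans hxy)
            (fun h => hne ⟨h.1.symm.trans h.2, h.1.symm⟩) (by linarith) (by linarith)
          linarith
        · have := le_triple_add_triple (T := T) (j := j) hs (hxy.symm.trans hxz) hxy.symm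
            (fun h => hne ⟨h.2.symm, h.2.symm.trans h.1⟩) (by linarith) (by linarith)
          linarith
  · have h0 : agreeInd T.dig j x y * agreeInd T.dig j x z = 0 := by
      rcases not_and_or.1 h with h' | h' <;> simp [agreeInd_of_not h']
    have h5 := mul_nonneg (agreeInd_nonneg (dig := T.dig) (j := j + 1) (w := x) (v := y))
      (agreeInd_nonneg (dig := T.dig) (j := j + 1) (w := x) (v := z))
    rw [h0]
    nlinarith

lemma cubeSum_eq : T.cubeSum p j =
    ∑ x, ∑ y, ∑ z, p x * p y * p z * (agreeInd T.dig j x y * agreeInd T.dig j x z) := by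
  refine Finset.sum_congr rfl fun x _ => ?_
  rw [classMass, sq, Finset.sum_mul_sum, Finset.mul_sum]
  refine Finset.sum_congr rfl fun y _ => ?_
  rw [Finset.mul_sum]
  refine Finset.sum_congr rfl fun z _ => ?_
  ring

lemma sum_cyclic (F : W → W → W → ℝ) :
    ∑ x, ∑ y, ∑ z, F y z x = ∑ x, ∑ y, ∑ z, F x y z := by
  rw [Finset.sum_comm]
  exact Finset.sum_congr rfl fun y _ => Finset.sum_comm

lemma mul_cubeSum_sub_le (hs : 0 < s) (hp : ∀ w, 0 ≤ p w) :
    (T.diam * T.len j) ^ (-s) / 2 * (T.cubeSum p j - T.cubeSum p (j + 1)) ≤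
      6 * ∑ w, p w * inner ℝ (T.unitField p j w) (T.field p j w) := by
  have hcyc1 : ∑ x, ∑ y, ∑ z, p x * p y * p z * T.triple j y z x =
      ∑ x, ∑ y, ∑ z, p x * p y * p z * T.triple j x y z := by
    rw [← sum_cyclic (fun x y z => p x * p y * p z * T.triple j x y z)]
    refine Finset.sum_congr rfl fun x _ => Finset.sum_congr rfl fun y _ =>
      Finset.sum_congr rfl fun z _ => ?_
    ring
  have hcyc2 : ∑ x, ∑ y, ∑ z, p x * p y * p z * T.triple j z x y =
      ∑ x, ∑ y, ∑ z, p x * p y * p z * T.triple j x y z := by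
    rw [← hcyc1, ← sum_cyclic (fun x y z => p x * p y * p z * T.triple j y z x)]
    refine Finset.sum_congr rfl fun x _ => Finset.sum_congr rfl fun y _ =>
      Finset.sum_congr rfl fun z _ => ?_
    ring
  have h := sum_inner_field_unitField (T := T) (p := p) (j := j)
  calc (T.diam * T.len j) ^ (-s) / 2 * (T.cubeSum p j - T.cubeSum p (j + 1))
      = ∑ x, ∑ y, ∑ z, p x * p y * p z * ((T.diam * T.len j) ^ (-s) / 2 *
        (agreeInd T.dig j x y * agreeInd T.dig j x z -
        agreeInd T.dig (j + 1) x y * agreeInd T.dig (j + 1) x z)) := by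
        rw [cubeSum_eq, cubeSum_eq]
        simp only [Finset.mul_sum, ← Finset.sum_sub_distrib]
        refine Finset.sum_congr rfl fun x _ => Finset.sum_congr rfl fun y _ =>
          Finset.sum_congr rfl fun z _ => ?_
        ring
    _ ≤ ∑ x, ∑ y, ∑ z, p x * p y * p z *
        (T.triple j x y z + T.triple j y z x + T.triple j z x y) :=
        Finset.sum_le_sum fun x _ => Finset.sum_le_sum fun y _ => Finset.sum_le_sum fun z _ =>
          mul_le_mul_of_nonneg_left (le_triple_cyclic hs x y z)
            (mul_nonneg (mul_nonneg (hp x) (hp y)) (hp z))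
    _ = _ := by
        simp only [mul_add, Finset.sum_add_distrib, hcyc1, hcyc2, ← h]
        ring

lemma cubeSum_le (hs : 0 < s) (hp : ∀ w, 0 ≤ p w) :
    T.cubeSum p j ≤ 2 * T.cubeSum p (j + 1) +
      144 * T.diam ^ (2 * s) * T.len j ^ (2 * s) * T.energy p j := by
  have hD := T.diam_pos
  have hl := T.len_pos j
  have h1 := mul_cubeSum_sub_le (T := T) (j := j) hs hp
  set Q := (T.diam * T.len j) ^ s with hQ
  have hQ0 : 0 < Q := by positivity
  have hQ1 : (T.diam * T.len j) ^ (-s) = Q⁻¹ := Real.rpow_neg (by positivity) _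
  have hQ2 : T.diam ^ (2 * s) * T.len j ^ (2 * s) = Q ^ 2 := by
    rw [hQ, ← Real.mul_rpow hD.le hl.le, ← Real.rpow_natCast, ← Real.rpow_mul (by positivity)]
    congr 1; push_cast; ring
  have h2 : ∀ w, p w * inner ℝ (T.unitField p j w) (T.field p j w) ≤
      Q⁻¹ / 24 * (p w * classMass T.dig p j w ^ 2) + 6 * Q * (p w * ‖T.field p j w‖ ^ 2) := by
    intro w
    have h3 := real_inner_le_norm (T.unitField p j w) (T.field p j w)
    have h4 := mul_le_mul_of_nonneg_right (norm_unitField_le (T := T) (j := j) (w := w) hp)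
      (norm_nonneg (T.field p j w))
    have h5 : classMass T.dig p j w * ‖T.field p j w‖ ≤
        Q⁻¹ / 24 * classMass T.dig p j w ^ 2 + 6 * Q * ‖T.field p j w‖ ^ 2 := by
      have h6 : 0 ≤ Q⁻¹ / 24 * (classMass T.dig p j w - 12 * Q * ‖T.field p j w‖) ^ 2 := by
        positivity
      have h7 : Q⁻¹ / 24 * (classMass T.dig p j w - 12 * Q * ‖T.field p j w‖) ^ 2 =
          Q⁻¹ / 24 * classMass T.dig p j w ^ 2 + 6 * Q * ‖T.field p j w‖ ^ 2 -
            classMass T.dig p j w * ‖T.field p j w‖ := by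
        field_simp; ring
      linarith
    nlinarith [mul_le_mul_of_nonneg_left ((h3.trans h4).trans h5) (hp w)]
  have h8 : ∑ w, p w * inner ℝ (T.unitField p j w) (T.field p j w) ≤
      Q⁻¹ / 24 * T.cubeSum p j + 6 * Q * T.energy p j := by
    rw [cubeSum, energy, Finset.mul_sum, Finset.mul_sum, ← Finset.sum_add_distrib]
    exact Finset.sum_le_sum fun w _ => h2 w
  rw [hQ1] at h1
  have h9 : Q⁻¹ / 2 * (T.cubeSum p j - T.cubeSum p (j + 1)) ≤
      6 * (Q⁻¹ / 24 * T.cubeSum p j + 6 * Q * T.energy p j) := by linarith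
  have h10 := mul_le_mul_of_nonneg_left h9 (by positivity : 0 ≤ 4 * Q)
  have h11 : 4 * Q * (Q⁻¹ / 2 * (T.cubeSum p j - T.cubeSum p (j + 1))) =
      2 * (T.cubeSum p j - T.cubeSum p (j + 1)) := by field_simp; ring
  have h12 : 4 * Q * (6 * (Q⁻¹ / 24 * T.cubeSum p j + 6 * Q * T.energy p j)) =
      T.cubeSum p j + 144 * Q ^ 2 * T.energy p j := by field_simp; ring
  rw [h11, h12] at h10
  rw [mul_assoc 144, hQ2]
  linarith

end DigitTree

end EnergyBound

section EnergySum

open scoped Classical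

variable {d : ℕ} {s : ℝ} {W : Type*} [Fintype W] {T : DigitTree d s W} {p : W → ℝ}

lemma sum_half_pow_succ (f : ℕ → ℝ) (n : ℕ) :
    ∑ j ∈ Finset.range (n + 1), (1 / 2 : ℝ) ^ (n - j) * f j =
      (∑ j ∈ Finset.range n, (1 / 2 : ℝ) ^ (n - 1 - j) * f j) / 2 + f n := by
  rw [Finset.sum_range_succ, Nat.sub_self, pow_zero, one_mul, Finset.sum_div]
  congr 1
  refine Finset.sum_congr rfl fun j hj => ?_
  have hj' := Finset.mem_range.1 hj
  rw [show n - j = (n - 1 - j) + 1 by omega, pow_succ]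
  ring

lemma sum_half_pow_le (n : ℕ) : ∑ j ∈ Finset.range n, (1 / 2 : ℝ) ^ (n - 1 - j) ≤ 2 := by
  induction n with
  | zero => norm_num
  | succ n ih =>
    have h := sum_half_pow_succ (fun _ => 1) n
    simp only [mul_one] at h
    rw [Nat.add_sub_cancel, h]
    linarith

namespace DigitTree

lemma len_le_half_pow (hl : ∀ j, T.len (j + 1) ≤ T.len j / 2) {j k : ℕ} (hjk : j ≤ k) :
    T.len k ≤ (1 / 2 : ℝ) ^ (k - j) * T.len j := by
  induction k, hjk using Nat.le_induction with
  | base => simp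
  | succ k hjk ih =>
    rw [show k + 1 - j = (k - j) + 1 by omega, pow_succ]
    linarith [hl k]

lemma abs_sum_inner_field_le_half_pow (hs : 0 < s) (hp : ∀ w, 0 ≤ p w) {η : ℝ} (hη : 0 < η)
    (hη' : ∀ j, T.gap j ^ (-(s + 1)) * T.digitSum j * T.len (j + 1) ^ (s + 1) ≤ η)
    (hl : ∀ j, T.len (j + 1) ≤ T.len j / 2) {j k : ℕ} (hjk : j < k) :
    2 * |∑ w, p w * inner ℝ (T.field p j w) (T.field p k w)| ≤
      (s + 2) * T.diam * η * (1 / 2) ^ (k - 1 - j) *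
        (T.len (j + 1) ^ (-(2 * s)) * T.cubeSum p (j + 1) + T.energy p k) := by
  rcases isEmpty_or_nonempty W with hW | hW
  · simp [cubeSum, energy]
  have hD := T.diam_pos
  have hl1 := T.len_pos (j + 1)
  refine abs_sum_inner_field_le hs hp hjk (by positivity) ?_
  have h1 := len_le_half_pow hl (Nat.succ_le_of_lt hjk)
  rw [show k - (j + 1) = k - 1 - j by omega] at h1
  have h2 : T.len (j + 1) ^ (s + 1) * T.len (j + 1) ^ (-s) = T.len (j + 1) := by
    rw [← Real.rpow_add hl1]; simp
  have h3 := T.digitSum_nonneg j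
  have h4 := T.gap_pos j
  calc (s + 2) * T.diam * T.len k * T.gap j ^ (-(s + 1)) * T.digitSum j
      ≤ (s + 2) * T.diam * ((1 / 2) ^ (k - 1 - j) * T.len (j + 1)) *
          T.gap j ^ (-(s + 1)) * T.digitSum j := by gcongr
    _ = (s + 2) * T.diam * (1 / 2) ^ (k - 1 - j) *
          (T.gap j ^ (-(s + 1)) * T.digitSum j * T.len (j + 1) ^ (s + 1)) *
          T.len (j + 1) ^ (-s) := by
        nth_rw 1 [← h2]; ring
    _ ≤ (s + 2) * T.diam * (1 / 2) ^ (k - 1 - j) * η * T.len (j + 1) ^ (-s) := by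
        have := hη' j
        gcongr
    _ = _ := by ring

lemma sum_energy_le (hs : 0 < s) (hp : ∀ w, 0 ≤ p w) {η : ℝ} (hη : 0 < η)
    (hη' : ∀ j, T.gap j ^ (-(s + 1)) * T.digitSum j * T.len (j + 1) ^ (s + 1) ≤ η)
    (hl : ∀ j, T.len (j + 1) ≤ T.len j / 2) (n : ℕ) :
    ∑ k ∈ Finset.range n, T.energy p k ≤
      ∑ w, p w * ‖∑ j ∈ Finset.range n, T.field p j w‖ ^ 2 +
      (s + 2) * T.diam * η * (2 * ∑ i ∈ Finset.range n,
          T.len (i + 1) ^ (-(2 * s)) * T.cubeSum p (i + 1) -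
        2 * ∑ j ∈ Finset.range n, (1 / 2) ^ (n - 1 - j) *
          (T.len (j + 1) ^ (-(2 * s)) * T.cubeSum p (j + 1))) +
      2 * ((s + 2) * T.diam * η) * ∑ k ∈ Finset.range n, T.energy p k := by
  set δ := (s + 2) * T.diam * η with hδ
  have hD := T.diam_pos
  have hδ0 : 0 < δ := by positivity
  set a : ℕ → ℝ := fun j => T.len (j + 1) ^ (-(2 * s)) * T.cubeSum p (j + 1) with ha
  induction n with
  | zero => simp
  | succ n ih =>
    have h1 : ∑ w, p w * ‖∑ j ∈ Finset.range (n + 1), T.field p j w‖ ^ 2 =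
        ∑ w, p w * ‖∑ j ∈ Finset.range n, T.field p j w‖ ^ 2 + T.energy p n +
        ∑ j ∈ Finset.range n, 2 * ∑ w, p w * inner ℝ (T.field p j w) (T.field p n w) := by
      rw [energy, ← Finset.mul_sum, Finset.sum_comm, Finset.mul_sum, ← Finset.sum_add_distrib,
        ← Finset.sum_add_distrib]
      refine Finset.sum_congr rfl fun w _ => ?_
      rw [Finset.sum_range_succ, norm_add_sq_real, sum_inner, ← Finset.mul_sum]
      ring
    have h2 : -(∑ j ∈ Finset.range n, δ * (1 / 2) ^ (n - 1 - j) * (a j + T.energy p n)) ≤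
        ∑ j ∈ Finset.range n, 2 * ∑ w, p w * inner ℝ (T.field p j w) (T.field p n w) := by
      rw [← Finset.sum_neg_distrib]
      refine Finset.sum_le_sum fun j hj => ?_
      have h3 := abs_sum_inner_field_le_half_pow hs hp hη hη' hl (Finset.mem_range.1 hj)
      have h4 := neg_abs_le (∑ w, p w * inner ℝ (T.field p j w) (T.field p n w))
      linarith
    have h3 : ∑ j ∈ Finset.range n, δ * (1 / 2) ^ (n - 1 - j) * (a j + T.energy p n) =
        δ * ∑ j ∈ Finset.range n, (1 / 2) ^ (n - 1 - j) * a j +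
        δ * T.energy p n * ∑ j ∈ Finset.range n, (1 / 2 : ℝ) ^ (n - 1 - j) := by
      rw [Finset.mul_sum, Finset.mul_sum, ← Finset.sum_add_distrib]
      refine Finset.sum_congr rfl fun j _ => ?_
      ring
    have h4 : δ * T.energy p n * ∑ j ∈ Finset.range n, (1 / 2 : ℝ) ^ (n - 1 - j) ≤
        δ * T.energy p n * 2 :=
      mul_le_mul_of_nonneg_left (sum_half_pow_le n) (mul_nonneg hδ0.le (energy_nonneg hp))
    have h5 := sum_half_pow_succ a n
    have h6 : T.len (n + 1) ^ (-(2 * s)) * T.cubeSum p (n + 1) = a n := by rw [ha]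
    rw [h1, Finset.sum_range_succ, Finset.sum_range_succ _ n, Nat.add_sub_cancel, h5, h6]
    nlinarith

/-- The energy bound: the cubes of the class masses are controlled by the square norm of the
total field. -/
theorem sum_cubeSum_le (hs : 0 < s) (hp : ∀ w, 0 ≤ p w) {η τ : ℝ} (hη : 0 < η)
    (hη' : ∀ j, T.gap j ^ (-(s + 1)) * T.digitSum j * T.len (j + 1) ^ (s + 1) ≤ η)
    (hηs : (s + 2) * T.diam * η * (2 * (144 * T.diam ^ (2 * s)) + 1) ≤ 1 / 4)
    (hτ : 0 < τ) (hτ2 : τ ≤ 1 / 2) (hτs : τ ^ (2 * s) ≤ 1 / 4)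
    (hl : ∀ j, T.len (j + 1) ≤ τ * T.len j) (n : ℕ) :
    ∑ j ∈ Finset.range n, T.len j ^ (-(2 * s)) * T.cubeSum p j ≤
      (4 * (144 * T.diam ^ (2 * s)) + 1) *
        (∑ w, p w * ‖∑ j ∈ Finset.range n, T.field p j w‖ ^ 2 +
          T.len n ^ (-(2 * s)) * T.cubeSum p n) := by
  have hD := T.diam_pos
  have hl2 : ∀ j, T.len (j + 1) ≤ T.len j / 2 := fun j => by
    nlinarith [hl j, T.len_pos j]
  have h1 := sum_energy_le hs hp hη hη' hl2 n
  set C := 144 * T.diam ^ (2 * s) with hC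
  have hC0 : 0 < C := by positivity
  set δ := (s + 2) * T.diam * η with hδ
  have hδ0 : 0 < δ := by positivity
  set a : ℕ → ℝ := fun j => T.len j ^ (-(2 * s)) * T.cubeSum p j with ha
  have ha0 : ∀ j, 0 ≤ a j := fun j =>
    mul_nonneg (Real.rpow_nonneg (T.len_pos j).le _) (cubeSum_nonneg hp)
  set B := ∑ k ∈ Finset.range n, T.energy p k with hB
  have hB0 : 0 ≤ B := Finset.sum_nonneg fun _ _ => energy_nonneg hp
  have h2 : ∀ j, a j ≤ a (j + 1) / 2 + C * T.energy p j := by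
    intro j
    have hlj := T.len_pos j
    have hlj1 := T.len_pos (j + 1)
    have h3 := cubeSum_le (T := T) (j := j) hs hp
    have h4 : T.len j ^ (-(2 * s)) * T.len j ^ (2 * s) = 1 := by
      rw [← Real.rpow_add hlj]; simp
    have h5 : T.len j ^ (-(2 * s)) ≤ T.len (j + 1) ^ (-(2 * s)) / 4 := by
      have h6 : T.len (j + 1) ^ (2 * s) ≤ T.len j ^ (2 * s) / 4 := by
        calc T.len (j + 1) ^ (2 * s) ≤ (τ * T.len j) ^ (2 * s) :=
              Real.rpow_le_rpow hlj1.le (hl j) (by positivity)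
          _ = τ ^ (2 * s) * T.len j ^ (2 * s) := Real.mul_rpow hτ.le hlj.le
          _ ≤ 1 / 4 * T.len j ^ (2 * s) := by gcongr
          _ = _ := by ring
      rw [Real.rpow_neg hlj.le, Real.rpow_neg hlj1.le]
      have h7 : 0 < T.len (j + 1) ^ (2 * s) := by positivity
      have h8 : 0 < T.len j ^ (2 * s) := by positivity
      rw [div_eq_mul_inv, ← mul_inv, inv_le_inv₀ h8 (by positivity)]
      linarith
    calc a j ≤ T.len j ^ (-(2 * s)) * (2 * T.cubeSum p (j + 1) +
          144 * T.diam ^ (2 * s) * T.len j ^ (2 * s) * T.energy p j) :=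
          mul_le_mul_of_nonneg_left h3 (by positivity)
      _ = T.len j ^ (-(2 * s)) * (2 * T.cubeSum p (j + 1)) +
          C * (T.len j ^ (-(2 * s)) * T.len j ^ (2 * s)) * T.energy p j := by ring
      _ ≤ T.len (j + 1) ^ (-(2 * s)) / 4 * (2 * T.cubeSum p (j + 1)) +
          C * (T.len j ^ (-(2 * s)) * T.len j ^ (2 * s)) * T.energy p j := by
          have := cubeSum_nonneg (T := T) (j := j + 1) hp
          gcongr
      _ = _ := by rw [h4]; simp only [ha]; ring
  have h3 : ∑ j ∈ Finset.range n, a j ≤ (∑ j ∈ Finset.range n, a (j + 1)) / 2 + C * B := by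
    rw [hB, Finset.sum_div, Finset.mul_sum, ← Finset.sum_add_distrib]
    exact Finset.sum_le_sum fun j _ => h2 j
  have h4 : ∑ j ∈ Finset.range n, a (j + 1) = ∑ j ∈ Finset.range n, a j + a n - a 0 := by
    have h5 := Finset.sum_range_succ a n
    rw [Finset.sum_range_succ'] at h5
    linarith
  have h5 : 0 ≤ ∑ j ∈ Finset.range n, (1 / 2 : ℝ) ^ (n - 1 - j) * a (j + 1) :=
    Finset.sum_nonneg fun j _ => mul_nonneg (by positivity) (ha0 _)
  have h6 := ha0 0
  have h7 := ha0 n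
  set A := ∑ j ∈ Finset.range n, a j
  set Q := ∑ w, p w * ‖∑ j ∈ Finset.range n, T.field p j w‖ ^ 2
  have hA : A ≤ a n + 2 * (C * B) := by linarith
  have hQ : B ≤ Q + δ * (2 * (A + a n)) + 2 * δ * B := by
    refine h1.trans ?_
    have : δ * (2 * ∑ i ∈ Finset.range n, a (i + 1) -
        2 * ∑ j ∈ Finset.range n, (1 / 2) ^ (n - 1 - j) * a (j + 1)) ≤ δ * (2 * (A + a n)) := by
      refine mul_le_mul_of_nonneg_left ?_ hδ0.le
      linarith
    linarith
  have hδ4 : δ ≤ 1 / 4 := by nlinarith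
  have hB2 : B ≤ 2 * Q + 2 * a n := by
    have e1 : δ * (2 * (A + a n)) ≤ δ * (4 * a n + 4 * (C * B)) :=
      mul_le_mul_of_nonneg_left (by linarith) hδ0.le
    have e2 : δ * (2 * C + 1) * B ≤ 1 / 4 * B := mul_le_mul_of_nonneg_right hηs hB0
    have e3 : δ * a n ≤ 1 / 4 * a n := mul_le_mul_of_nonneg_right hδ4 h7
    nlinarith
  have hQ0 : 0 ≤ Q := Finset.sum_nonneg fun w _ => mul_nonneg (hp w) (sq_nonneg _)
  calc A ≤ a n + 2 * (C * (2 * Q + 2 * a n)) := by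
        have := mul_le_mul_of_nonneg_left hB2 hC0.le
        linarith
    _ ≤ _ := by nlinarith

end DigitTree

end EnergySum

section Scales

variable {s : ℝ} {h : ℝ → ℝ}

/-- The density whose integral near zero decides whether the gauge is admissible. -/
def gaugeDensity (h : ℝ → ℝ) (s t : ℝ) : ℝ := (h t / t ^ s) ^ 2 / t

lemma continuousOn_gaugeDensity (hcont : ContinuousOn h (Ici 0)) :
    ContinuousOn (gaugeDensity h s) (Ioi 0) := by
  have h1 : ContinuousOn (fun t : ℝ => t ^ s) (Ioi 0) :=
    continuousOn_id.rpow_const fun t ht => Or.inl (ne_of_gt ht)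
  exact (((hcont.mono Ioi_subset_Ici_self).div h1 fun t ht =>
    (Real.rpow_pos_of_pos ht s).ne').pow 2).div continuousOn_id fun t ht => ne_of_gt ht

lemma intervalIntegrable_gaugeDensity (hcont : ContinuousOn h (Ici 0)) {u v : ℝ} (hu : 0 < u)
    (hv : 0 < v) : IntervalIntegrable (gaugeDensity h s) volume u v :=
  ((continuousOn_gaugeDensity hcont).mono fun _ ht =>
    (lt_min hu hv).trans_le ht.1).intervalIntegrable

lemma gaugeFun_nonneg (hmono : StrictMonoOn h (Ici 0)) (h0 : h 0 = 0) {t : ℝ} (ht : 0 ≤ t) :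
    0 ≤ h t := h0 ▸ hmono.monotoneOn self_mem_Ici ht ht

lemma gaugeFun_pos (hmono : StrictMonoOn h (Ici 0)) (h0 : h 0 = 0) {t : ℝ} (ht : 0 < t) :
    0 < h t := h0 ▸ hmono self_mem_Ici ht.le ht

lemma gaugeDensity_nonneg {t : ℝ} (ht : 0 ≤ t) : 0 ≤ gaugeDensity h s t := by
  unfold gaugeDensity; positivity

lemma integral_gaugeDensity_le (hs : 0 < s) (hcont : ContinuousOn h (Ici 0))
    (hmono : StrictMonoOn h (Ici 0)) (h0 : h 0 = 0) {u v : ℝ} (hu : 0 < u) (huv : u ≤ v) :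
    ∫ t in u..v, gaugeDensity h s t ≤ h v ^ 2 * u ^ (-(2 * s)) / (2 * s) := by
  have hv : 0 < v := hu.trans_le huv
  have hnot : (0 : ℝ) ∉ uIcc u v := fun h' => absurd ((lt_min hu hv).trans_le h'.1) (lt_irrefl _)
  have hint : IntervalIntegrable (fun t : ℝ => h v ^ 2 * t ^ (-(2 * s) - 1)) volume u v :=
    (intervalIntegral.intervalIntegrable_rpow (Or.inr hnot)).const_mul _
  calc ∫ t in u..v, gaugeDensity h s t
      ≤ ∫ t in u..v, h v ^ 2 * t ^ (-(2 * s) - 1) := by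
        refine intervalIntegral.integral_mono_on huv
          (intervalIntegrable_gaugeDensity hcont hu hv) hint fun t ht => ?_
        have ht0 : 0 < t := hu.trans_le ht.1
        have h1 : h t ≤ h v := hmono.monotoneOn ht0.le hv.le ht.2
        have h2 := gaugeFun_nonneg hmono h0 ht0.le
        have h3 : t ^ (-(2 * s) - 1) = 1 / (t ^ s) ^ 2 / t := by
          rw [Real.rpow_sub ht0, Real.rpow_one, Real.rpow_neg ht0.le, ← Real.rpow_natCast,
            ← Real.rpow_mul ht0.le, one_div]
          congr 3; push_cast; ring
        rw [h3, gaugeDensity, div_pow]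
        have : h t ^ 2 ≤ h v ^ 2 := by gcongr
        calc h t ^ 2 / (t ^ s) ^ 2 / t ≤ h v ^ 2 / (t ^ s) ^ 2 / t := by gcongr
          _ = _ := by ring
    _ = h v ^ 2 * ((v ^ (-(2 * s)) - u ^ (-(2 * s))) / (-(2 * s))) := by
        rw [intervalIntegral.integral_const_mul,
          integral_rpow (Or.inr ⟨by linarith, hnot⟩), sub_add_cancel]
    _ = h v ^ 2 * ((u ^ (-(2 * s)) - v ^ (-(2 * s))) / (2 * s)) := by
        rw [div_neg, ← neg_div, neg_sub]
    _ ≤ h v ^ 2 * (u ^ (-(2 * s)) / (2 * s)) := by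
        have : 0 ≤ v ^ (-(2 * s)) := by positivity
        gcongr
        linarith
    _ = _ := by ring

lemma intervalIntegrable_of_bounded (hcont : ContinuousOn h (Ici 0)) {b M : ℝ} (hb : 0 < b)
    {u : ℕ → ℝ} (hu0 : ∀ n, 0 < u n) (hu : Tendsto u atTop (𝓝 0)) (hub : ∀ n, u n ≤ b)
    (hM : ∀ n, ∫ t in u n..b, gaugeDensity h s t ≤ M) {a : ℝ} (ha : 0 < a) :
    IntervalIntegrable (gaugeDensity h s) volume 0 a := by
  refine IntervalIntegrable.trans (b := b) ?_ (intervalIntegrable_gaugeDensity hcont hb ha)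
  rw [intervalIntegrable_iff_integrableOn_Ioc_of_le hb.le]
  refine integrableOn_Ioc_of_intervalIntegral_norm_bounded_left (I := M) (l := atTop) (a := u)
    (fun n => ?_) hu (Eventually.of_forall fun n => ?_)
  · exact (intervalIntegrable_iff_integrableOn_Ioc_of_le (hub n)).1
      (intervalIntegrable_gaugeDensity hcont (hu0 n) hb)
  · refine le_trans (le_of_eq ?_) (hM n)
    rw [← intervalIntegral.integral_of_le (hub n)]
    refine intervalIntegral.integral_congr fun t ht => ?_
    rw [uIcc_of_le (hub n)] at ht
    exact Real.norm_of_nonneg (gaugeDensity_nonneg ((hu0 n).le.trans ht.1))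

lemma integral_gaugeDensity_add (hcont : ContinuousOn h (Ici 0)) {u v w : ℝ} (hu : 0 < u)
    (hv : 0 < v) (hw : 0 < w) :
    ∫ t in u..w, gaugeDensity h s t =
      (∫ t in u..v, gaugeDensity h s t) + ∫ t in v..w, gaugeDensity h s t :=
  (intervalIntegral.integral_add_adjacent_intervals
    (intervalIntegrable_gaugeDensity hcont hu hv)
    (intervalIntegrable_gaugeDensity hcont hv hw)).symm

/-- The bound for the integral over the range of scales below `ℓ` on which the gauge decays
faster than a fixed power. -/
lemma integral_gaugeDensity_le_of_decay (hs : 0 < s) (hcont : ContinuousOn h (Ici 0))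
    (hmono : StrictMonoOn h (Ici 0)) (h0 : h 0 = 0) {D κ τ ℓ : ℝ} (hκ : 0 < κ) (hκs : κ * s < D)
    (hτ : 0 < τ) (hτ1 : τ ≤ 1) (hℓ : 0 < ℓ) (e : ℕ)
    (hdecay : ∀ i < e, h (τ * ℓ * ((2 : ℝ) ^ (-κ)) ^ i) ≤ ((2 : ℝ) ^ (-D)) ^ i * h ℓ) :
    ∫ t in (τ * ℓ * ((2 : ℝ) ^ (-κ)) ^ e)..ℓ, gaugeDensity h s t ≤
      τ ^ (-(2 * s)) / (2 * s) * (1 + 2 ^ (2 * κ * s) * (1 - 2 ^ (2 * (κ * s - D)))⁻¹) *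
        (h ℓ / ℓ ^ s) ^ 2 := by
  set q : ℝ := 2 ^ (2 * (κ * s - D)) with hq
  have hq0 : 0 < q := by positivity
  have hq1 : q < 1 := Real.rpow_lt_one_of_one_lt_of_neg (by norm_num) (by linarith)
  set b : ℝ := 2 ^ (-κ) with hb
  have hb0 : 0 < b := by positivity
  have hb1 : b < 1 := Real.rpow_lt_one_of_one_lt_of_neg (by norm_num) (by linarith)
  have hτℓ : (τ * ℓ) ^ (-(2 * s)) * h ℓ ^ 2 = τ ^ (-(2 * s)) * (h ℓ / ℓ ^ s) ^ 2 := by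
    rw [Real.mul_rpow hτ.le hℓ.le, div_pow, Real.rpow_neg hℓ.le, ← Real.rpow_natCast (ℓ ^ s),
      ← Real.rpow_mul hℓ.le]
    have : s * ((2 : ℕ) : ℝ) = 2 * s := by push_cast; ring
    rw [this]
    ring
  have hℓ0 := gaugeFun_nonneg hmono h0 hℓ.le
  have key : ∫ t in (τ * ℓ * b ^ e)..ℓ, gaugeDensity h s t ≤
      (τ * ℓ) ^ (-(2 * s)) * h ℓ ^ 2 / (2 * s) *
        (1 + 2 ^ (2 * κ * s) * ∑ i ∈ Finset.range e, q ^ i) := by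
    induction e with
    | zero =>
      refine (integral_gaugeDensity_le hs hcont hmono h0 (by positivity)
        (by simpa using mul_le_of_le_one_left hℓ.le hτ1)).trans (le_of_eq ?_)
      simp
      ring
    | succ e ih =>
      have ih' := ih fun i hi => hdecay i (by omega)
      rw [integral_gaugeDensity_add hcont (v := τ * ℓ * b ^ e) (by positivity) (by positivity) hℓ]
      have h1 := integral_gaugeDensity_le (s := s) hs hcont hmono h0
        (u := τ * ℓ * b ^ (e + 1)) (v := τ * ℓ * b ^ e) (by positivity)
        (by
          refine mul_le_mul_of_nonneg_left ?_ (by positivity)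
          exact pow_le_pow_of_le_one hb0.le hb1.le (by omega))
      have h2 := hdecay e (by omega)
      have h3 : (τ * ℓ * b ^ (e + 1)) ^ (-(2 * s)) =
          (τ * ℓ) ^ (-(2 * s)) * (2 ^ (2 * κ * s) * (2 ^ (2 * κ * s)) ^ e) := by
        rw [Real.mul_rpow (by positivity) (by positivity), pow_succ' (2 ^ (2 * κ * s) : ℝ) e |>.symm]
        congr 1
        rw [← Real.rpow_natCast, ← Real.rpow_mul hb0.le, mul_comm, Real.rpow_mul hb0.le,
          Real.rpow_natCast, hb, ← Real.rpow_mul (by norm_num)]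
        congr 2; ring
      have h4 : q = 2 ^ (2 * κ * s) * ((2 : ℝ) ^ (-D)) ^ 2 := by
        rw [hq, ← Real.rpow_natCast, ← Real.rpow_mul (by norm_num), ← Real.rpow_add (by norm_num)]
        congr 1; push_cast; ring
      have h5 : h (τ * ℓ * b ^ e) ^ 2 ≤ (((2 : ℝ) ^ (-D)) ^ e * h ℓ) ^ 2 := by
        have := gaugeFun_nonneg hmono h0 (t := τ * ℓ * b ^ e) (by positivity)
        gcongr
      have h6 : h (τ * ℓ * b ^ e) ^ 2 * (τ * ℓ * b ^ (e + 1)) ^ (-(2 * s)) / (2 * s) ≤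
          (τ * ℓ) ^ (-(2 * s)) * h ℓ ^ 2 / (2 * s) * (2 ^ (2 * κ * s) * q ^ e) := by
        rw [h3]
        calc _ ≤ (((2 : ℝ) ^ (-D)) ^ e * h ℓ) ^ 2 * ((τ * ℓ) ^ (-(2 * s)) *
              (2 ^ (2 * κ * s) * (2 ^ (2 * κ * s)) ^ e)) / (2 * s) := by gcongr
          _ = _ := by rw [h4, mul_pow]; ring
      rw [Finset.sum_range_succ]
      linarith
  refine key.trans ?_
  rw [hτℓ]
  have hgeom : ∑ i ∈ Finset.range e, q ^ i ≤ (1 - q)⁻¹ := by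
    rw [← tsum_geometric_of_lt_one hq0.le hq1]
    exact (summable_geometric_of_lt_one hq0.le hq1).sum_le_tsum _ fun _ _ => by positivity
  calc _ ≤ τ ^ (-(2 * s)) * (h ℓ / ℓ ^ s) ^ 2 / (2 * s) *
        (1 + 2 ^ (2 * κ * s) * (1 - q)⁻¹) := by gcongr
    _ = _ := by ring

/-- One step of the construction of scales. -/
lemma exists_next_scale (hs : 0 < s) (hcont : ContinuousOn h (Ici 0))
    (hmono : StrictMonoOn h (Ici 0)) (h0 : h 0 = 0)
    (hdiv : ∃ a : ℝ, 0 < a ∧ ¬ IntervalIntegrable (gaugeDensity h s) volume 0 a)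
    {D κ τ : ℝ} (hκ : 0 < κ) (hκs : κ * s < D) (hτ : 0 < τ) (hτ1 : τ < 1) :
    ∃ C : ℝ, 0 < C ∧ ∀ ℓ : ℝ, 0 < ℓ → ∃ (e : ℕ) (ℓ' : ℝ), 1 ≤ e ∧ 0 < ℓ' ∧
      h ℓ' = ((2 : ℝ) ^ (-D)) ^ e * h ℓ ∧ ℓ' ≤ τ * ℓ * ((2 : ℝ) ^ (-κ)) ^ e ∧
      ∫ t in ℓ'..ℓ, gaugeDensity h s t ≤ C * ((h ℓ / ℓ ^ s) ^ 2 + (h ℓ' / ℓ' ^ s) ^ 2) := by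
  set q : ℝ := 2 ^ (2 * (κ * s - D)) with hq
  have hq1 : q < 1 := Real.rpow_lt_one_of_one_lt_of_neg (by norm_num) (by linarith)
  set b : ℝ := 2 ^ (-κ) with hb
  have hb0 : 0 < b := by positivity
  have hb1 : b < 1 := Real.rpow_lt_one_of_one_lt_of_neg (by norm_num) (by linarith)
  set g : ℝ := 2 ^ (-D) with hg
  have hg0 : 0 < g := by positivity
  have hg1 : g < 1 := Real.rpow_lt_one_of_one_lt_of_neg (by norm_num) (by nlinarith)
  set C₀ := τ ^ (-(2 * s)) / (2 * s) * (1 + 2 ^ (2 * κ * s) * (1 - q)⁻¹) with hC₀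
  have hq2 : 0 < 1 - q := by linarith
  have hC₀0 : 0 < C₀ := by positivity
  set C₁ := (g⁻¹) ^ 2 / (2 * s) with hC₁
  have hC₁0 : 0 < C₁ := by positivity
  refine ⟨C₀ + C₁, by positivity, fun ℓ hℓ => ?_⟩
  have hℓ0 := gaugeFun_pos hmono h0 hℓ
  have hex : ∃ e : ℕ, g ^ e * h ℓ ≤ h (τ * ℓ * b ^ e) := by
    by_contra hcon
    push Not at hcon
    obtain ⟨a, ha, hna⟩ := hdiv
    refine hna (intervalIntegrable_of_bounded hcont hℓ (u := fun n => τ * ℓ * b ^ n)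
      (M := C₀ * (h ℓ / ℓ ^ s) ^ 2)
      (fun n => by positivity) ?_ (fun n => ?_) (fun n => ?_) ha)
    · simpa using (tendsto_pow_atTop_nhds_zero_of_lt_one hb0.le hb1).const_mul (τ * ℓ)
    · have : b ^ n ≤ 1 := pow_le_one₀ hb0.le hb1.le
      have h1 : τ * b ^ n ≤ 1 := by nlinarith
      nlinarith
    · exact integral_gaugeDensity_le_of_decay hs hcont hmono h0 hκ hκs hτ hτ1.le hℓ n
        fun i _ => (hcon i).le
  classical
  set e := Nat.find hex with he
  have hspec := Nat.find_spec hex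
  have hmin : ∀ i < e, h (τ * ℓ * b ^ i) ≤ g ^ i * h ℓ := fun i hi =>
    (not_le.1 (Nat.find_min hex hi)).le
  have he1 : 1 ≤ e := by
    rw [Nat.one_le_iff_ne_zero]
    intro h1
    rw [← he, h1] at hspec
    simp only [pow_zero, one_mul, mul_one] at hspec
    exact absurd (hmono (show (0 : ℝ) ≤ τ * ℓ by positivity) hℓ.le (by nlinarith))
      (not_lt.2 hspec)
  have hv0 : 0 < τ * ℓ * b ^ e := by positivity
  obtain ⟨ℓ', hℓ', hℓ'e⟩ : g ^ e * h ℓ ∈ h '' Icc 0 (τ * ℓ * b ^ e) :=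
    intermediate_value_Icc hv0.le (hcont.mono Icc_subset_Ici_self)
      ⟨by rw [h0]; positivity, hspec⟩
  have hℓ'0 : 0 < ℓ' := by
    refine lt_of_le_of_ne hℓ'.1 fun h1 => ?_
    rw [← h1, h0] at hℓ'e
    have : 0 < g ^ e * h ℓ := by positivity
    linarith
  refine ⟨e, ℓ', he1, hℓ'0, hℓ'e, hℓ'.2, ?_⟩
  have h1 := integral_gaugeDensity_le_of_decay hs hcont hmono h0 hκ hκs hτ hτ1.le hℓ e hmin
  have h2 := integral_gaugeDensity_le hs hcont hmono h0 hℓ'0 hℓ'.2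
  rw [integral_gaugeDensity_add hcont hℓ'0 hv0 hℓ]
  have h3 : h (τ * ℓ * b ^ e) ≤ g⁻¹ * h ℓ' := by
    have h4 := hmin (e - 1) (by omega)
    have h5 : g ^ e = g * g ^ (e - 1) := by rw [← pow_succ']; congr 1; omega
    rw [hℓ'e, h5]
    calc h (τ * ℓ * b ^ e) ≤ h (τ * ℓ * b ^ (e - 1)) := by
          refine hmono.monotoneOn (show (0 : ℝ) ≤ _ by positivity) (show (0 : ℝ) ≤ _ by positivity) ?_
          exact mul_le_mul_of_nonneg_left (pow_le_pow_of_le_one hb0.le hb1.le (by omega))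
            (by positivity)
      _ ≤ _ := h4
      _ = _ := by field_simp
  have h6 : h (τ * ℓ * b ^ e) ^ 2 * ℓ' ^ (-(2 * s)) / (2 * s) ≤ C₁ * (h ℓ' / ℓ' ^ s) ^ 2 := by
    have h7 : ℓ' ^ (-(2 * s)) = ((ℓ' ^ s) ^ 2)⁻¹ := by
      rw [Real.rpow_neg hℓ'0.le, ← Real.rpow_natCast, ← Real.rpow_mul hℓ'0.le]
      congr 2; push_cast; ring
    have h8 := gaugeFun_nonneg hmono h0 hv0.le
    calc _ ≤ (g⁻¹ * h ℓ') ^ 2 * ℓ' ^ (-(2 * s)) / (2 * s) := by gcongr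
      _ = _ := by rw [h7, div_pow, hC₁]; ring
  have h9 : 0 ≤ C₀ * (h ℓ' / ℓ' ^ s) ^ 2 := by positivity
  have h10 : 0 ≤ C₁ * (h ℓ / ℓ ^ s) ^ 2 := by positivity
  linarith

/-- The sequence of scales of the Cantor set. -/
theorem exists_scales (hs : 0 < s) (hcont : ContinuousOn h (Ici 0))
    (hmono : StrictMonoOn h (Ici 0)) (h0 : h 0 = 0)
    (hdiv : ∃ a : ℝ, 0 < a ∧ ¬ IntervalIntegrable (gaugeDensity h s) volume 0 a)
    {d : ℕ} {κ τ : ℝ} (hκ : 0 < κ) (hκs : κ * s < d) (hτ : 0 < τ) (hτ1 : τ < 1) :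
    ∃ (ℓ : ℕ → ℝ) (K : ℕ → ℕ), ℓ 0 = 1 ∧ (∀ j, 0 < ℓ j) ∧ (∀ j, 2 ≤ K j) ∧
      (∀ j, (K j : ℝ) ^ d * h (ℓ (j + 1)) = h (ℓ j)) ∧
      (∀ j, ℓ (j + 1) ≤ τ * ℓ j * (K j : ℝ) ^ (-κ)) ∧
      ∀ M, ∃ n, M < ∑ j ∈ Finset.range n, (h (ℓ j) / ℓ j ^ s) ^ 2 := by
  obtain ⟨C, hC, hstep⟩ := exists_next_scale hs hcont hmono h0 hdiv hκ hκs hτ hτ1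
  choose! e nxt he hpos hval hle hint using hstep
  let ℓ : ℕ → ℝ := fun n => nxt^[n] 1
  have hsucc : ∀ j, ℓ (j + 1) = nxt (ℓ j) := fun j => Function.iterate_succ_apply' nxt j 1
  have hℓ : ∀ j, 0 < ℓ j := by
    intro j
    induction j with
    | zero => exact one_pos
    | succ j ih => rw [hsucc]; exact hpos _ ih
  have hb1 : ∀ n : ℕ, ((2 : ℝ) ^ (-κ)) ^ n ≤ 1 := fun n =>
    pow_le_one₀ (by positivity) (Real.rpow_le_one_of_one_le_of_nonpos (by norm_num) (by linarith))
  have hlτ : ∀ j, ℓ (j + 1) ≤ τ * ℓ j := fun j => by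
    rw [hsucc]
    exact (hle _ (hℓ j)).trans (mul_le_of_le_one_right (mul_pos hτ (hℓ j)).le (hb1 _))
  have hpow : ∀ n, ℓ n ≤ τ ^ n := by
    intro n
    induction n with
    | zero => exact le_of_eq (by simp [ℓ])
    | succ n ih => rw [pow_succ']; exact (hlτ n).trans (mul_le_mul_of_nonneg_left ih hτ.le)
  refine ⟨ℓ, fun j => 2 ^ e (ℓ j), rfl, hℓ, fun j => ?_, fun j => ?_, fun j => ?_, fun M => ?_⟩
  · calc 2 = 2 ^ 1 := by norm_num
      _ ≤ _ := Nat.pow_le_pow_right (by norm_num) (he _ (hℓ j))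
  · rw [hsucc, hval _ (hℓ j), ← mul_assoc]
    rw [Real.rpow_neg (by norm_num), Real.rpow_natCast]
    push_cast
    rw [← pow_mul, mul_comm (e (ℓ j)) d, pow_mul, ← mul_pow, mul_inv_cancel₀ (by positivity),
      one_pow, one_mul]
  · rw [hsucc]
    refine (hle _ (hℓ j)).trans (le_of_eq ?_)
    push_cast
    rw [← Real.rpow_natCast, ← Real.rpow_natCast, ← Real.rpow_mul (by norm_num),
      ← Real.rpow_mul (by norm_num), mul_comm (-κ)]
  · by_contra! hcon
    obtain ⟨a, ha, hna⟩ := hdiv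
    refine hna (intervalIntegrable_of_bounded hcont (b := 1) (M := 2 * C * M) one_pos hℓ ?_
      (fun n => (hpow n).trans (pow_le_one₀ hτ.le hτ1.le)) (fun n => ?_) ha)
    · exact squeeze_zero (fun n => (hℓ n).le) hpow
        (tendsto_pow_atTop_nhds_zero_of_lt_one hτ.le hτ1)
    · have h1 : ∫ t in ℓ n..1, gaugeDensity h s t ≤ C * (∑ j ∈ Finset.range n,
          (h (ℓ j) / ℓ j ^ s) ^ 2 + ∑ j ∈ Finset.range n, (h (ℓ (j + 1)) / ℓ (j + 1) ^ s) ^ 2) := by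
        induction n with
        | zero => simp [ℓ]
        | succ n ih =>
          rw [integral_gaugeDensity_add hcont (hℓ (n + 1)) (hℓ n) one_pos]
          have h2 := hint _ (hℓ n)
          rw [← hsucc] at h2
          rw [Finset.sum_range_succ, Finset.sum_range_succ _ n]
          linarith
      have h3 : ∑ j ∈ Finset.range n, (h (ℓ (j + 1)) / ℓ (j + 1) ^ s) ^ 2 ≤ M := by
        have h4 := hcon (n + 1)
        rw [Finset.sum_range_succ'] at h4
        have : 0 ≤ (h (ℓ 0) / ℓ 0 ^ s) ^ 2 := by positivity
        linarith
      have h5 := mul_le_mul_of_nonneg_left (add_le_add (hcon n) h3) hC.le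
      linarith

end Scales

section Lattice

variable {d : ℕ}

lemma summable_norm_rpow_int_pi {r : ℝ} (hr : r < -d) :
    Summable fun z : Fin d → ℤ => ‖z‖ ^ r := by
  let b := Pi.basisFun ℝ (Fin d)
  have h := ZLattice.summable_norm_rpow (Submodule.span ℤ (Set.range b)) r
    (by rw [ZLattice.rank ℝ]; simpa using hr)
  have hm (z : Fin d → ℤ) : (fun i => (z i : ℝ)) ∈ Submodule.span ℤ (Set.range b) := by
    rw [b.mem_span_iff_repr_mem ℤ]
    exact fun i => ⟨z i, by simp [b]⟩
  let f (z : Fin d → ℤ) : Submodule.span ℤ (Set.range b) := ⟨fun i => (z i : ℝ), hm z⟩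
  have hf : Function.Injective f := fun z z' hz => by
    funext i
    have := congrFun (congrArg Subtype.val hz) i
    exact Int.cast_injective this
  refine (h.comp_injective hf).congr fun z => ?_
  rfl

/-- One plus the sum of the reciprocals of `‖z‖ ^ (d + 1)` over the nonzero lattice points. -/
def latticeSum (d : ℕ) : ℝ := 1 + ∑' z : Fin d → ℤ, ‖z‖ ^ (-((d : ℝ) + 1))

lemma latticeSum_pos : 0 < latticeSum d :=
  add_pos_of_pos_of_nonneg one_pos (tsum_nonneg fun _ => by positivity)

lemma sum_norm_sub_rpow_le {s : ℝ} (hs : 0 < s) (hsd : s < d) {K : ℝ} (hK : 0 ≤ K)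
    (F : Finset (Fin d → ℤ))
    (z₀ : Fin d → ℤ) (hF : ∀ z ∈ F, ‖z₀ - z‖ ≤ K) :
    ∑ z ∈ F, ‖z₀ - z‖ ^ (-(s + 1)) ≤ K ^ (d - s) * latticeSum d := by
  have h1 : ∑ z ∈ F, ‖z₀ - z‖ ^ (-((d : ℝ) + 1)) ≤ latticeSum d := by
    have hinj : Function.Injective fun z : Fin d → ℤ => z₀ - z := sub_right_injective
    have hsum := summable_norm_rpow_int_pi (d := d) (r := -((d : ℝ) + 1)) (by linarith)
    refine le_trans (le_of_eq ?_) ((hsum.sum_le_tsum (F.map ⟨_, hinj⟩)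
      fun _ _ => by positivity).trans (le_add_of_nonneg_left zero_le_one))
    rw [Finset.sum_map]
    rfl
  refine le_trans ?_ (mul_le_mul_of_nonneg_left h1 (by positivity : 0 ≤ K ^ (d - s)))
  rw [Finset.mul_sum]
  refine Finset.sum_le_sum fun z hz => ?_
  rcases eq_or_ne z₀ z with rfl | hne
  · rw [sub_self, norm_zero, Real.zero_rpow (by linarith), Real.zero_rpow (by linarith), mul_zero]
  · have hpos : 0 < ‖z₀ - z‖ := norm_pos_iff.2 (sub_ne_zero.2 hne)
    calc ‖z₀ - z‖ ^ (-(s + 1)) = ‖z₀ - z‖ ^ (d - s) * ‖z₀ - z‖ ^ (-((d : ℝ) + 1)) := by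
          rw [← Real.rpow_add hpos]; congr 1; ring
      _ ≤ _ := by
          gcongr
          exact hF z hz

lemma EuclideanSpace.norm_le_mul_of_forall_abs_le {c : ℝ} (hc : 0 ≤ c)
    {v : EuclideanSpace ℝ (Fin d)} (hv : ∀ i, |v i| ≤ c) : ‖v‖ ≤ d * c := by
  have h : ‖v‖ ^ 2 ≤ (d * c) ^ 2 := by
    rw [EuclideanSpace.norm_sq_eq]
    calc ∑ i, ‖v i‖ ^ 2 ≤ ∑ _i : Fin d, c ^ 2 := by
          refine Finset.sum_le_sum fun i _ => ?_
          rw [Real.norm_eq_abs]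
          exact pow_le_pow_left₀ (abs_nonneg _) (hv i) 2
      _ = d * c ^ 2 := by simp
      _ ≤ (d : ℝ) ^ 2 * c ^ 2 := by
          gcongr
          rcases Nat.eq_zero_or_pos d with h | h
          · simp [h]
          · have : (1 : ℝ) ≤ d := by exact_mod_cast h
            nlinarith
      _ = _ := by ring
  exact le_of_sq_le_sq h (by positivity)

lemma EuclideanSpace.abs_apply_le_norm (v : EuclideanSpace ℝ (Fin d)) (i : Fin d) :
    |v i| ≤ ‖v‖ := PiLp.norm_apply_le v i

end Lattice

/-- The side lengths and subdivision numbers of a Cantor set of `s`-Riesz type. -/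
structure Scales (d : ℕ) (s : ℝ) where
  /-- The side length of the cubes of a level. -/
  len : ℕ → ℝ
  /-- The number of subdivisions of a side of a cube. -/
  num : ℕ → ℕ
  /-- A bound for the ratio of a side length and the previous gap. -/
  ratio : ℝ
  one_le_dim : 1 ≤ d
  exp_pos : 0 < s
  exp_lt : s < d
  len_pos : ∀ j, 0 < len j
  two_le_num : ∀ j, 2 ≤ num j
  ratio_pos : 0 < ratio
  ratio_le : 20 * d * ratio ≤ 1
  len_succ_le : ∀ j, len (j + 1) ≤ ratio * len j * (num j : ℝ) ^ (-((d + 1) / (s + 1)))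

namespace Scales

variable {d : ℕ} {s : ℝ} (S : Scales d s) {a b : ℕ → Fin d → ℤ} {j k m n : ℕ}

/-- The step of the grid into which a cube is subdivided. -/
def gap (j : ℕ) : ℝ := S.len j / S.num j

lemma num_pos (j : ℕ) : (0 : ℝ) < S.num j := by
  have := S.two_le_num j
  positivity

lemma one_le_num (j : ℕ) : (1 : ℝ) ≤ S.num j := by
  have := S.two_le_num j
  exact_mod_cast (by omega : 1 ≤ S.num j)

lemma gap_pos (j : ℕ) : 0 < S.gap j := div_pos (S.len_pos j) (S.num_pos j)

lemma gap_mul_num (j : ℕ) : S.gap j * S.num j = S.len j :=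
  div_mul_cancel₀ _ (S.num_pos j).ne'

lemma one_le_dim' (S : Scales d s) : (1 : ℝ) ≤ d := by exact_mod_cast S.one_le_dim

lemma len_succ_le_gap_rpow (j : ℕ) :
    S.len (j + 1) ≤ S.ratio * S.gap j * (S.num j : ℝ) ^ (-((d - s) / (s + 1))) := by
  refine (S.len_succ_le j).trans (le_of_eq ?_)
  have h1 : -((d - s) / (s + 1)) = 1 + -((d + 1) / (s + 1)) := by
    have := S.exp_pos
    field_simp
    ring
  rw [h1, Real.rpow_add (S.num_pos j), Real.rpow_one, ← S.gap_mul_num]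
  ring

lemma len_succ_le_gap (j : ℕ) : S.len (j + 1) ≤ S.ratio * S.gap j := by
  refine (S.len_succ_le_gap_rpow j).trans (mul_le_of_le_one_right
    (mul_pos S.ratio_pos (S.gap_pos j)).le (Real.rpow_le_one_of_one_le_of_nonpos (S.one_le_num j) ?_))
  have := S.exp_pos
  have := S.exp_lt
  exact neg_nonpos.2 (div_nonneg (by linarith) (by linarith))

lemma dim_mul_len_succ_le (j : ℕ) : 20 * (d * S.len (j + 1)) ≤ S.gap j := by
  have h1 := S.len_succ_le_gap j
  have h2 := S.ratio_le
  have h3 := S.gap_pos j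
  have h4 := S.one_le_dim'
  calc 20 * (d * S.len (j + 1)) ≤ 20 * (d * (S.ratio * S.gap j)) := by gcongr
    _ = 20 * d * S.ratio * S.gap j := by ring
    _ ≤ 1 * S.gap j := by gcongr
    _ = _ := one_mul _

lemma len_succ_le_gap' (j : ℕ) : 20 * S.len (j + 1) ≤ S.gap j := by
  have h1 := S.dim_mul_len_succ_le j
  have h2 := S.len_pos (j + 1)
  have h4 := S.one_le_dim'
  nlinarith

lemma gap_le_len (j : ℕ) : 2 * S.gap j ≤ S.len j := by
  rw [← S.gap_mul_num, mul_comm]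
  have := S.gap_pos j
  have h : (2 : ℝ) ≤ S.num j := by exact_mod_cast S.two_le_num j
  gcongr

lemma ratio_le_half : S.ratio ≤ 1 / 2 := by
  have h1 := S.ratio_le
  have h2 := S.one_le_dim'
  have h3 := S.ratio_pos
  nlinarith

lemma len_succ_le_len (j : ℕ) : S.len (j + 1) ≤ S.ratio * S.len j := by
  have h1 := S.len_succ_le_gap j
  have h2 := S.gap_le_len j
  have h3 := S.gap_pos j
  have h4 := S.ratio_pos
  nlinarith

lemma len_antitone : Antitone S.len := by
  refine antitone_nat_of_succ_le fun j => ?_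
  have h1 := S.len_succ_le_len j
  have h2 := S.ratio_le_half
  have h3 := S.len_pos j
  nlinarith

lemma tendsto_len : Tendsto S.len atTop (𝓝 0) := by
  have h : ∀ j, S.len j ≤ S.len 0 * (1 / 2) ^ j := by
    intro j
    induction j with
    | zero => simp
    | succ j ih =>
      have h1 := S.len_succ_le_len j
      have h2 := S.ratio_le_half
      have h3 := S.len_pos j
      rw [pow_succ]
      nlinarith
  refine squeeze_zero (fun j => (S.len_pos j).le) h ?_
  have := (tendsto_pow_atTop_nhds_zero_of_lt_one (r := (1 / 2 : ℝ)) (by norm_num)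
    (by norm_num)).const_mul (S.len 0)
  simpa using this

/-- The digit sequences of the construction. -/
def Valid (a : ℕ → Fin d → ℤ) : Prop := ∀ j i, 0 ≤ a j i ∧ a j i + 1 ≤ S.num j

/-- The lower corner of the level `k` cube with digits `a`. -/
def corner (a : ℕ → Fin d → ℤ) (k : ℕ) : EuclideanSpace ℝ (Fin d) :=
  WithLp.toLp 2 fun i => ∑ j ∈ Finset.range k, S.gap j * a j i

/-- The level `k` cube with digits `a`. -/
def cell (a : ℕ → Fin d → ℤ) (k : ℕ) : Set (EuclideanSpace ℝ (Fin d)) :=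
  {y | ∀ i, S.corner a k i ≤ y i ∧ y i ≤ S.corner a k i + S.len k}

lemma corner_apply (i : Fin d) :
    S.corner a k i = ∑ j ∈ Finset.range k, S.gap j * (a j i : ℝ) := rfl

lemma corner_succ_apply (i : Fin d) :
    S.corner a (k + 1) i = S.corner a k i + S.gap k * (a k i : ℝ) := by
  rw [corner_apply, corner_apply, Finset.sum_range_succ]

lemma corner_congr (h : ∀ j < k, a j = b j) : S.corner a k = S.corner b k := by
  ext i
  rw [corner_apply, corner_apply]
  exact Finset.sum_congr rfl fun j hj => by rw [h j (Finset.mem_range.1 hj)]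

lemma cell_congr (h : ∀ j < k, a j = b j) : S.cell a k = S.cell b k := by
  rw [cell, cell, S.corner_congr h]

variable {S} in
lemma Valid.corner_le (ha : S.Valid a) (hmn : m ≤ n) (i : Fin d) :
    S.corner a m i ≤ S.corner a n i ∧
      S.corner a n i + S.len n ≤ S.corner a m i + S.len m := by
  induction n, hmn using Nat.le_induction with
  | base => exact ⟨le_rfl, le_rfl⟩
  | succ n hmn ih =>
    have h1 := (ha n i).1
    have h2 := (ha n i).2
    have h3 := S.gap_pos n
    have h4 := S.gap_mul_num n
    have h5 := S.len_succ_le_gap' n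
    have h6 := S.len_pos (n + 1)
    have h7 : (0 : ℝ) ≤ a n i := by exact_mod_cast h1
    have h8 : (a n i : ℝ) + 1 ≤ S.num n := by exact_mod_cast h2
    rw [S.corner_succ_apply]
    constructor
    · nlinarith
    · nlinarith

variable {S} in
lemma Valid.cell_subset (ha : S.Valid a) (hmn : m ≤ n) : S.cell a n ⊆ S.cell a m := by
  intro y hy i
  have h1 := hy i
  have h2 := ha.corner_le hmn i
  constructor <;> linarith

lemma corner_mem_cell : S.corner a k ∈ S.cell a k :=
  fun _ => ⟨le_rfl, by linarith [S.len_pos k]⟩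

lemma abs_sub_corner_le {y : EuclideanSpace ℝ (Fin d)} (hy : y ∈ S.cell a k) (i : Fin d) :
    |y i - S.corner a k i| ≤ S.len k := by
  have := hy i
  rw [abs_le]
  constructor <;> linarith [S.len_pos k]

lemma abs_sub_le {y y' : EuclideanSpace ℝ (Fin d)} (hy : y ∈ S.cell a k) (hy' : y' ∈ S.cell a k)
    (i : Fin d) : |y i - y' i| ≤ S.len k := by
  have := hy i
  have := hy' i
  rw [abs_le]
  constructor <;> linarith [S.len_pos k]

lemma norm_sub_le {y y' : EuclideanSpace ℝ (Fin d)} (hy : y ∈ S.cell a k)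
    (hy' : y' ∈ S.cell a k) : ‖y - y'‖ ≤ d * S.len k :=
  EuclideanSpace.norm_le_mul_of_forall_abs_le (S.len_pos k).le fun i => S.abs_sub_le hy hy' i

lemma mul_norm_sub_le (hab : ∀ i < j, a i = b i) {y y' : EuclideanSpace ℝ (Fin d)}
    (hy : ∀ i, |y i - S.corner a (j + 1) i| ≤ 5 * S.len (j + 1))
    (hy' : ∀ i, |y' i - S.corner b (j + 1) i| ≤ 5 * S.len (j + 1)) :
    S.gap j / 2 * ‖a j - b j‖ ≤ ‖y - y'‖ := by
  have hg := S.gap_pos j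
  have hl := S.len_succ_le_gap' j
  have h : ‖a j - b j‖ ≤ 2 / S.gap j * ‖y - y'‖ := by
    rw [pi_norm_le_iff_of_nonneg (by positivity)]
    intro i
    rw [Pi.sub_apply, Int.norm_eq_abs]
    by_cases hne : a j i = b j i
    · rw [hne, sub_self]; simp; positivity
    · have h1 : (1 : ℝ) ≤ |((a j i - b j i : ℤ) : ℝ)| := by
        exact_mod_cast Int.one_le_abs (sub_ne_zero.2 hne)
      have h2 := EuclideanSpace.abs_apply_le_norm (y - y') i
      have h3 := hy i
      have h4 := hy' i
      rw [S.corner_succ_apply] at h3 h4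
      rw [S.corner_congr hab] at h3
      rw [PiLp.sub_apply] at h2
      have h5 : S.gap j * ((a j i - b j i : ℤ) : ℝ) = (y i - y' i) -
          (y i - (S.corner b j i + S.gap j * (a j i : ℝ))) +
          (y' i - (S.corner b j i + S.gap j * (b j i : ℝ))) := by
        push_cast; ring
      have h6 : S.gap j * |((a j i - b j i : ℤ) : ℝ)| ≤ ‖y - y'‖ + 10 * S.len (j + 1) := by
        have h6 : |S.gap j * ((a j i - b j i : ℤ) : ℝ)| =
            S.gap j * |((a j i - b j i : ℤ) : ℝ)| := by rw [abs_mul, abs_of_pos hg]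
        rw [← h6, h5]
        refine (abs_add_le _ _).trans ?_
        have := abs_sub (y i - y' i) (y i - (S.corner b j i + S.gap j * (a j i : ℝ)))
        linarith
      rw [div_mul_eq_mul_div, le_div_iff₀ hg]
      nlinarith
  calc S.gap j / 2 * ‖a j - b j‖ ≤ S.gap j / 2 * (2 / S.gap j * ‖y - y'‖) := by gcongr
    _ = _ := by field_simp

/-- Finite digit strings. -/
abbrev Word (n : ℕ) : Type := (j : Fin n) → Fin d → Fin (S.num j)

/-- The digits of a finite string, continued by zeros. -/
def digits (n : ℕ) (j : ℕ) (w : S.Word n) (i : Fin d) : ℤ :=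
  if h : j < n then ((w ⟨j, h⟩ i : ℕ) : ℤ) else 0

/-- The digit sequence of a finite string. -/
def seq (w : S.Word n) (j : ℕ) : Fin d → ℤ := S.digits n j w

lemma digits_of_le (w : S.Word n) (h : n ≤ j) : S.digits n j w = 0 := by
  funext i
  exact dif_neg (by omega)

lemma valid_seq (w : S.Word n) : S.Valid (S.seq w) := by
  intro j i
  rw [seq, digits]
  split_ifs with h
  · have := (w ⟨j, h⟩ i).2
    constructor
    · positivity
    · exact_mod_cast this
  · have := S.two_le_num j
    omega

lemma corner_seq_of_le (w : S.Word n) (h : n ≤ k) : S.corner (S.seq w) k = S.corner (S.seq w) n := by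
  induction k, h using Nat.le_induction with
  | base => rfl
  | succ k hk ih =>
    ext i
    rw [S.corner_succ_apply, ih, seq, S.digits_of_le w hk]
    simp

lemma eq_of_agree {w w' : S.Word n} (h : Agree (S.digits n) n w w') : w = w' := by
  funext j i
  have := congrFun (h j j.2) i
  rw [digits, digits, dif_pos j.2, dif_pos j.2] at this
  exact Fin.ext (by exact_mod_cast this)

lemma exists_word (ha : S.Valid a) (n : ℕ) : ∃ w : S.Word n, ∀ j < n, S.seq w j = a j := by
  refine ⟨fun j i => ⟨(a j i).toNat, ?_⟩, fun j hj => ?_⟩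
  · have := ha j i
    omega
  · funext i
    have := ha j i
    rw [seq, digits, dif_pos hj]
    exact Int.toNat_of_nonneg this.1

lemma corner_seq_mem_cell (w : S.Word n) (k : ℕ) : S.corner (S.seq w) n ∈ S.cell (S.seq w) k := by
  rcases le_total n k with h | h
  · rw [← S.corner_seq_of_le w h]
    exact S.corner_mem_cell
  · exact (S.valid_seq w).cell_subset h S.corner_mem_cell

lemma norm_digits_sub_le (w w' : S.Word n) (j : ℕ) :
    ‖S.digits n j w - S.digits n j w'‖ ≤ S.num j := by
  rw [pi_norm_le_iff_of_nonneg (S.num_pos j).le]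
  intro i
  have h1 := S.valid_seq w j i
  have h2 := S.valid_seq w' j i
  rw [seq] at h1 h2
  rw [Pi.sub_apply, Int.norm_eq_abs]
  have : |S.digits n j w i - S.digits n j w' i| ≤ S.num j := by
    rw [abs_le]; omega
  exact_mod_cast this

open scoped Classical in
/-- The digit tree of the corners of the level `n` cubes. -/
def tree (n : ℕ) : DigitTree d s (S.Word n) where
  dig := S.digits n
  pos w := S.corner (S.seq w) n
  len := S.len
  gap j := S.gap j / 2
  diam := d
  digitSum j := (S.num j : ℝ) ^ (d - s) * latticeSum d
  len_pos := S.len_pos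
  gap_pos j := half_pos (S.gap_pos j)
  diam_pos := zero_lt_one.trans_le S.one_le_dim'
  norm_le j w w' h := by
    refine S.norm_sub_le (a := S.seq w) (S.corner_seq_mem_cell w j) ?_
    exact S.cell_congr (a := S.seq w) (b := S.seq w') h ▸ S.corner_seq_mem_cell w' j
  le_norm j w w' h := by
    refine S.mul_norm_sub_le (a := S.seq w) (b := S.seq w') h (fun i => ?_) fun i => ?_
    · exact (S.abs_sub_corner_le (S.corner_seq_mem_cell w (j + 1)) i).trans
        (by linarith [S.len_pos (j + 1)])
    · exact (S.abs_sub_corner_le (S.corner_seq_mem_cell w' (j + 1)) i).trans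
        (by linarith [S.len_pos (j + 1)])
  sum_le j w := by
    refine sum_norm_sub_rpow_le S.exp_pos S.exp_lt (S.num_pos j).le _ _ fun z hz => ?_
    obtain ⟨w', -, rfl⟩ := Finset.mem_image.1 hz
    exact S.norm_digits_sub_le w w' j
  diam_le_gap j := by
    have h1 := S.dim_mul_len_succ_le j
    have h2 := S.gap_pos j
    linarith

/-- The smallness parameter of the construction. -/
def eta : ℝ := 2 ^ (s + 1) * latticeSum d * S.ratio ^ (s + 1)

lemma eta_pos : 0 < S.eta := by
  have := latticeSum_pos (d := d)
  have := S.ratio_pos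
  unfold eta
  positivity

lemma gap_rpow_mul_le (j : ℕ) :
    (S.gap j / 2) ^ (-(s + 1)) * ((S.num j : ℝ) ^ (d - s) * latticeSum d) *
      S.len (j + 1) ^ (s + 1) ≤ S.eta := by
  have hg := S.gap_pos j
  have hK := S.num_pos j
  have hr := S.ratio_pos
  have hs := S.exp_pos
  have hZ := latticeSum_pos (d := d)
  have h1 : S.len (j + 1) ^ (s + 1) ≤
      S.ratio ^ (s + 1) * S.gap j ^ (s + 1) * (S.num j : ℝ) ^ (-(d - s)) := by
    calc S.len (j + 1) ^ (s + 1) ≤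
          (S.ratio * S.gap j * (S.num j : ℝ) ^ (-((d - s) / (s + 1)))) ^ (s + 1) :=
          Real.rpow_le_rpow (S.len_pos _).le (S.len_succ_le_gap_rpow j) (by linarith)
      _ = _ := by
          rw [Real.mul_rpow (by positivity) (by positivity), Real.mul_rpow hr.le hg.le,
            ← Real.rpow_mul hK.le]
          congr 2
          field_simp
  calc _ ≤ (S.gap j / 2) ^ (-(s + 1)) * ((S.num j : ℝ) ^ (d - s) * latticeSum d) *
        (S.ratio ^ (s + 1) * S.gap j ^ (s + 1) * (S.num j : ℝ) ^ (-(d - s))) := by gcongr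
    _ = S.eta := by
        rw [Real.div_rpow hg.le (by norm_num), Real.rpow_neg hg.le, Real.rpow_neg (by norm_num),
          Real.rpow_neg hK.le, eta]
        have : S.gap j ^ (s + 1) ≠ 0 := (Real.rpow_pos_of_pos hg _).ne'
        have : (S.num j : ℝ) ^ (d - s) ≠ 0 := (Real.rpow_pos_of_pos hK _).ne'
        have : (2 : ℝ) ^ (s + 1) ≠ 0 := (Real.rpow_pos_of_pos (by norm_num) _).ne'
        field_simp

/-- The Cantor set of the construction. -/
def cantorSet : Set (EuclideanSpace ℝ (Fin d)) := ⋂ n, ⋃ w : S.Word n, S.cell (S.seq w) n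

lemma isClosed_cell : IsClosed (S.cell a k) := by
  have h : S.cell a k = ⋂ i, (fun y : EuclideanSpace ℝ (Fin d) => y i) ⁻¹'
      Icc (S.corner a k i) (S.corner a k i + S.len k) := by
    ext y
    simp [cell]
  rw [h]
  exact isClosed_iInter fun i => isClosed_Icc.preimage (by fun_prop)

lemma isCompact_cell : IsCompact (S.cell a k) :=
  Metric.isCompact_of_isClosed_isBounded S.isClosed_cell
    ((Metric.isBounded_closedBall (x := S.corner a k) (r := d * S.len k)).subset fun y hy => by
      rw [mem_closedBall, dist_eq_norm]
      exact S.norm_sub_le hy S.corner_mem_cell)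

lemma isClosed_cantorSet : IsClosed S.cantorSet :=
  isClosed_iInter fun _ => isClosed_iUnion_of_finite fun _ => S.isClosed_cell

lemma isCompact_cantorSet : IsCompact S.cantorSet :=
  (isCompact_iUnion fun _w : S.Word 0 => S.isCompact_cell).of_isClosed_subset
    S.isClosed_cantorSet (iInter_subset _ 0)

lemma corner_mem_cantorSet (w : S.Word n) : S.corner (S.seq w) n ∈ S.cantorSet := by
  refine mem_iInter.2 fun k => mem_iUnion.2 ?_
  obtain ⟨v, hv⟩ := S.exists_word (S.valid_seq w) k
  exact ⟨v, S.cell_congr hv ▸ S.corner_seq_mem_cell w k⟩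

end Scales

section Transform

variable {d : ℕ} {s : ℝ}

lemma measurable_rieszKernel : Measurable (rieszKernel d s) := by
  unfold rieszKernel
  fun_prop

lemma norm_integral_rieszKernel_le {ν : Measure (EuclideanSpace ℝ (Fin d))}
    {u : EuclideanSpace ℝ (Fin d)} {δ C : ℝ} (hδ : 0 < δ) (hν : ∀ᵐ y ∂ν, δ ≤ dist y u)
    (hu : ‖rieszTransform d s ν u‖ ≤ C) : ‖∫ y, rieszKernel d s (y - u) ∂ν‖ ≤ C := by
  have h : rieszTransform d s ν u = ∫ y, rieszKernel d s (y - u) ∂ν := by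
    refine Tendsto.limUnder_eq (tendsto_const_nhds.congr' ?_)
    filter_upwards [Ioo_mem_nhdsGT hδ] with ε hε
    rw [truncRiesz, Measure.restrict_eq_self_of_ae_mem]
    filter_upwards [hν] with y hy
    exact hε.2.trans_le hy
  rwa [← h]

end Transform

section Tree

variable {d : ℕ} {W : Type*} {dig : ℕ → W → Fin d → ℤ} {k : ℕ} {w v : W}

lemma exists_branch (h : ¬ Agree dig k w v) : ∃ j < k, Agree dig j w v ∧ dig j w ≠ dig j v := by
  induction k with
  | zero => exact absurd agree_zero h
  | succ k ih =>
    by_cases h' : Agree dig k w v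
    · exact ⟨k, by omega, h', fun h'' => h (agree_succ.2 ⟨h', h''⟩)⟩
    · obtain ⟨j, hj, hj'⟩ := ih h'
      exact ⟨j, by omega, hj'⟩

lemma sum_branchInd : ∑ j ∈ Finset.range k, branchInd dig j w v = 1 - agreeInd dig k w v := by
  simp_rw [branchInd_eq_sub]
  rw [Finset.sum_range_sub', agreeInd_of agree_zero]

lemma sum_eq_agree_add_branch [Fintype W] {F : Type*} [AddCommGroup F] [Module ℝ F]
    (dig : ℕ → W → Fin d → ℤ) (k : ℕ) (w : W) (f : W → F) :
    ∑ w', f w' = ∑ w', agreeInd dig k w w' • f w' +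
      ∑ j ∈ Finset.range k, ∑ w', branchInd dig j w w' • f w' := by
  rw [Finset.sum_comm, ← Finset.sum_add_distrib]
  refine Finset.sum_congr rfl fun w' _ => ?_
  rw [← Finset.sum_smul, sum_branchInd, ← add_smul, add_sub_cancel, one_smul]

end Tree

namespace Scales

variable {d : ℕ} {s : ℝ} (S : Scales d s) {ν : Measure (EuclideanSpace ℝ (Fin d))}
  {u : EuclideanSpace ℝ (Fin d)} {j k n : ℕ} {w w' : S.Word n}

variable (ν) in
/-- The mass of a level `n` cube. -/
def cellMass (n : ℕ) (w : S.Word n) : ℝ := ν.real (S.cell (S.seq w) n)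

variable (ν) in
/-- The contribution of a level `n` cube to the Riesz transform. -/
def cellField (n : ℕ) (u : EuclideanSpace ℝ (Fin d)) (w : S.Word n) : EuclideanSpace ℝ (Fin d) :=
  ∫ y in S.cell (S.seq w) n, rieszKernel d s (y - u) ∂ν

/-- The point `u` lies close to the level `k` cube of `w`. -/
def IsNear (w : S.Word n) (k : ℕ) (u : EuclideanSpace ℝ (Fin d)) : Prop :=
  ∀ i, |u i - S.corner (S.seq w) k i| ≤ 3 * S.len k

lemma cellMass_nonneg (w : S.Word n) : 0 ≤ S.cellMass ν n w := measureReal_nonneg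

variable {S}

lemma IsNear.mul_norm_digits_sub_le (hu : S.IsNear w k u) (hjk : j < k) (hkn : k ≤ n)
    (h : Agree (S.digits n) j w w') {y : EuclideanSpace ℝ (Fin d)}
    (hy : y ∈ S.cell (S.seq w') n) :
    S.gap j / 2 * ‖S.digits n j w - S.digits n j w'‖ ≤ ‖y - u‖ := by
  rw [norm_sub_rev y u]
  refine S.mul_norm_sub_le (a := S.seq w) (b := S.seq w') h (fun i => ?_) fun i => ?_
  · have h1 := (S.valid_seq w).corner_le (Nat.succ_le_of_lt hjk) i
    have h2 := abs_le.1 (hu i)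
    have h3 := S.len_antitone (Nat.succ_le_of_lt hjk)
    have h4 := S.len_pos k
    rw [Nat.succ_eq_add_one] at h1 h3
    rw [abs_le]
    constructor <;> linarith
  · have h1 := S.abs_sub_corner_le ((S.valid_seq w').cell_subset
      (Nat.succ_le_of_lt (hjk.trans_le hkn)) hy) i
    have := S.len_pos (j + 1)
    exact h1.trans (by rw [Nat.succ_eq_add_one]; linarith)

lemma IsNear.norm_rieszKernel_sub_le (hu : S.IsNear w k u) (hjk : j < k) (hkn : k ≤ n)
    (h : Agree (S.digits n) j w w') (hne : S.digits n j w ≠ S.digits n j w')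
    {y : EuclideanSpace ℝ (Fin d)} (hy : y ∈ S.cell (S.seq w') n) :
    ‖rieszKernel d s (y - u) -
      rieszKernel d s (S.corner (S.seq w') n - S.corner (S.seq w) n)‖ ≤
      (s + 2) * (S.gap j / 2 * ‖S.digits n j w - S.digits n j w'‖) ^ (-(s + 1)) *
        (d * (5 * S.len k)) := by
  have hz := DigitTree.one_le_norm_sub hne
  have hg := S.gap_pos j
  have hs := S.exp_pos
  have hk := S.len_pos k
  have h1 : S.gap j / 2 * ‖S.digits n j w - S.digits n j w'‖ ≤
      ‖S.corner (S.seq w') n - S.corner (S.seq w) n‖ := by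
    rw [norm_sub_rev (S.corner _ n)]
    exact (S.tree n).le_norm j w w' h
  refine (rieszKernel_sub_le hs (by positivity)
    (hu.mul_norm_digits_sub_le hjk hkn h hy) h1).trans ?_
  gcongr
  refine EuclideanSpace.norm_le_mul_of_forall_abs_le (by positivity) fun i => ?_
  have h2 := abs_le.1 (S.abs_sub_corner_le hy i)
  have h3 := abs_le.1 (hu i)
  have h4 := S.len_antitone hkn
  have h5 := (S.valid_seq w).corner_le hkn i
  have h6 := S.len_pos n
  simp only [PiLp.sub_apply]
  rw [abs_le]
  constructor <;> linarith

lemma integrableOn_rieszKernel [IsFiniteMeasure ν] {ρ : ℝ} (hρ : 0 < ρ)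
    {A : Set (EuclideanSpace ℝ (Fin d))} (hA : MeasurableSet A) (hs : 0 < s)
    (h : ∀ y ∈ A, ρ ≤ ‖y - u‖) :
    IntegrableOn (fun y => rieszKernel d s (y - u)) A ν := by
  refine Measure.integrableOn_of_bounded (measure_ne_top _ _)
    (measurable_rieszKernel.comp (measurable_id.sub_const u)).aestronglyMeasurable
    (M := ρ ^ (-s)) ?_
  filter_upwards [ae_restrict_mem hA] with y hy
  exact norm_rieszKernel_le hs hρ (h y hy)

lemma IsNear.norm_cellField_sub_le [IsFiniteMeasure ν] (hu : S.IsNear w k u) (hjk : j < k)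
    (hkn : k ≤ n) (h : Agree (S.digits n) j w w') (hne : S.digits n j w ≠ S.digits n j w') :
    ‖S.cellField ν n u w' - S.cellMass ν n w' •
      rieszKernel d s (S.corner (S.seq w') n - S.corner (S.seq w) n)‖ ≤
      (s + 2) * (S.gap j / 2 * ‖S.digits n j w - S.digits n j w'‖) ^ (-(s + 1)) *
        (d * (5 * S.len k)) * S.cellMass ν n w' := by
  have hz := DigitTree.one_le_norm_sub hne
  have hg := S.gap_pos j
  have hm : MeasurableSet (S.cell (S.seq w') n) := S.isClosed_cell.measurableSet
  have hi := integrableOn_rieszKernel (ν := ν) (u := u) (s := s)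
    (ρ := S.gap j / 2 * ‖S.digits n j w - S.digits n j w'‖) (by positivity) hm S.exp_pos
    fun y hy => hu.mul_norm_digits_sub_le hjk hkn h hy
  have h1 : S.cellField ν n u w' - S.cellMass ν n w' •
      rieszKernel d s (S.corner (S.seq w') n - S.corner (S.seq w) n) =
      ∫ y in S.cell (S.seq w') n, (rieszKernel d s (y - u) -
        rieszKernel d s (S.corner (S.seq w') n - S.corner (S.seq w) n)) ∂ν := by
    rw [integral_sub hi integrableOn_const, setIntegral_const]
    rfl
  rw [h1]
  exact norm_setIntegral_le_of_norm_le_const (measure_lt_top _ _)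
    fun y hy => hu.norm_rieszKernel_sub_le hjk hkn h hne hy

lemma IsNear.norm_branch_add_field_le [IsFiniteMeasure ν] (hu : S.IsNear w k u) (hjk : j < k)
    (hkn : k ≤ n) :
    ‖∑ w', branchInd (S.digits n) j w w' • S.cellField ν n u w' +
      (S.tree n).field (S.cellMass ν n) j w‖ ≤
      (s + 2) * (S.gap j / 2) ^ (-(s + 1)) * (d * (5 * S.len k)) *
        classOsc (S.digits n) s (S.cellMass ν n) j w := by
  rw [DigitTree.field, ← Finset.sum_add_distrib, classOsc, Finset.mul_sum]
  refine (norm_sum_le _ _).trans (Finset.sum_le_sum fun w' _ => ?_)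
  have hg := S.gap_pos j
  by_cases hb : Agree (S.digits n) j w w' ∧ S.digits n j w ≠ S.digits n j w'
  · have h1 : branchInd (S.digits n) j w w' = 1 := if_pos hb
    have h2 := hu.norm_cellField_sub_le (ν := ν) hjk hkn hb.1 hb.2
    rw [Real.mul_rpow (by positivity) (norm_nonneg _)] at h2
    have h3 : (S.tree n).dig = S.digits n := rfl
    have h4 : rieszKernel d s ((S.tree n).pos w - (S.tree n).pos w') =
        -rieszKernel d s (S.corner (S.seq w') n - S.corner (S.seq w) n) := by
      rw [← rieszKernel_neg, neg_sub]
      rfl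
    rw [h3, h1, h4, agreeInd_of hb.1, one_smul, one_mul, smul_neg, ← sub_eq_add_neg, one_mul,
      digitWeight]
    refine h2.trans (le_of_eq ?_)
    ring
  · have h1 : branchInd (S.digits n) j w w' = 0 := if_neg hb
    have h3 : (S.tree n).dig = S.digits n := rfl
    rw [h3, h1]
    have hs := S.exp_pos
    have hk := S.len_pos k
    have := S.cellMass_nonneg (ν := ν) w'
    have := agreeInd_nonneg (dig := S.digits n) (j := j) (w := w) (v := w')
    have := digitWeight_nonneg (dig := S.digits n) (j := j) (w := w) (v := w') (s := s)
    simp only [zero_smul, zero_mul, add_zero, norm_zero]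
    positivity

variable (S) in
lemma sum_len_div_le (k : ℕ) : ∑ j ∈ Finset.range k, S.len k / S.len (j + 1) ≤ 2 := by
  induction k with
  | zero => simp
  | succ k ih =>
    have h1 := S.len_pos k
    have h2 := S.len_pos (k + 1)
    have h3 := S.len_succ_le_len k
    have h4 := S.ratio_le_half
    have h5 : S.len (k + 1) ≤ 1 / 2 * S.len k := by nlinarith
    rw [Finset.sum_range_succ, div_self h2.ne']
    have h6 : ∑ j ∈ Finset.range k, S.len (k + 1) / S.len (j + 1) ≤
        1 / 2 * ∑ j ∈ Finset.range k, S.len k / S.len (j + 1) := by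
      rw [Finset.mul_sum]
      refine Finset.sum_le_sum fun j _ => ?_
      rw [← mul_div_assoc]
      exact div_le_div_of_nonneg_right h5 (S.len_pos _).le
    linarith

variable (S) in
/-- The constant in the far field comparison. -/
def farConst : ℝ := 10 * d * (s + 2) * S.eta

lemma IsNear.norm_sum_branch_add_field_le [IsFiniteMeasure ν] (hu : S.IsNear w k u)
    (hkn : k ≤ n) {T : ℝ} (hT : 0 ≤ T)
    (hM : ∀ i ≤ k, ∀ v, classMass (S.digits n) (S.cellMass ν n) i v ≤ T * S.len i ^ s) :
    ‖∑ j ∈ Finset.range k, ∑ w', branchInd (S.digits n) j w w' • S.cellField ν n u w' +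
      ∑ j ∈ Finset.range k, (S.tree n).field (S.cellMass ν n) j w‖ ≤ S.farConst * T := by
  have hs := S.exp_pos
  have hk := S.len_pos k
  rw [← Finset.sum_add_distrib]
  calc _ ≤ ∑ j ∈ Finset.range k, 5 * d * (s + 2) * S.eta * T * (S.len k / S.len (j + 1)) := by
        refine (norm_sum_le _ _).trans (Finset.sum_le_sum fun j hj => ?_)
        have hjk := Finset.mem_range.1 hj
        have hg := S.gap_pos j
        have hl := S.len_pos (j + 1)
        refine (hu.norm_branch_add_field_le hjk hkn).trans ?_
        have h1 := classOsc_le (dig := S.digits n) (s := s) (w := w)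
          (fun w => S.cellMass_nonneg (ν := ν) w) ((S.tree n).sum_le j w) (hM (j + 1) hjk)
        have h2 := S.gap_rpow_mul_le j
        have h3 : S.len (j + 1) ^ (s + 1) = S.len (j + 1) ^ s * S.len (j + 1) :=
          Real.rpow_add_one hl.ne' s
        rw [h3] at h2
        calc _ ≤ (s + 2) * (S.gap j / 2) ^ (-(s + 1)) * (d * (5 * S.len k)) *
              ((S.num j : ℝ) ^ (d - s) * latticeSum d * (T * S.len (j + 1) ^ s)) := by
              gcongr
              exact h1
          _ = 5 * d * (s + 2) * T * (S.len k / S.len (j + 1)) *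
              ((S.gap j / 2) ^ (-(s + 1)) * ((S.num j : ℝ) ^ (d - s) * latticeSum d) *
              (S.len (j + 1) ^ s * S.len (j + 1))) := by
              field_simp
          _ ≤ 5 * d * (s + 2) * T * (S.len k / S.len (j + 1)) * S.eta := by gcongr
          _ = _ := by ring
    _ ≤ 5 * d * (s + 2) * S.eta * T * 2 := by
        rw [← Finset.mul_sum]
        have := S.eta_pos
        gcongr
        exact S.sum_len_div_le k
    _ = _ := by rw [farConst]; ring

end Scales

namespace Scales

variable {d : ℕ} {s : ℝ} {S : Scales d s} {ν : Measure (EuclideanSpace ℝ (Fin d))}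
  {u : EuclideanSpace ℝ (Fin d)} {j k n : ℕ} {w w' : S.Word n}

variable (S) in
lemma pairwise_disjoint_cell (n : ℕ) :
    Pairwise (Function.onFun Disjoint fun w : S.Word n => S.cell (S.seq w) n) := by
  refine fun w w' hne => Set.disjoint_left.2 fun y hy hy' => ?_
  obtain ⟨j, hj, h1, h2⟩ := exists_branch fun h => hne (S.eq_of_agree h)
  have hy1 : S.IsNear w n y := fun i =>
    (S.abs_sub_corner_le hy i).trans (by linarith [S.len_pos n])
  have h3 := hy1.mul_norm_digits_sub_le hj le_rfl h1 hy'
  have h4 := DigitTree.one_le_norm_sub h2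
  have h5 := S.gap_pos j
  rw [sub_self, norm_zero] at h3
  nlinarith

lemma ae_mem_iUnion_cell (hν : ν S.cantorSetᶜ = 0) (n : ℕ) :
    ∀ᵐ y ∂ν, y ∈ ⋃ w : S.Word n, S.cell (S.seq w) n := by
  have h : ∀ᵐ y ∂ν, y ∈ S.cantorSet := by
    rw [ae_iff]
    exact hν
  filter_upwards [h] with y hy
  exact mem_iInter.1 hy n

lemma sum_cellMass [IsFiniteMeasure ν] (hν : ν S.cantorSetᶜ = 0) (n : ℕ) :
    ∑ w, S.cellMass ν n w = ν.real univ := by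
  have h := measureReal_iUnion_fintype (μ := ν) (S.pairwise_disjoint_cell n)
    fun w => S.isClosed_cell.measurableSet
  refine h.symm.trans (measureReal_congr ?_)
  filter_upwards [ae_mem_iUnion_cell hν n] with y hy
  exact propext (iff_of_true hy trivial)

lemma IsNear.len_le_norm_sub (hu : S.IsNear w k u) (hkn : k ≤ n)
    (ha : ∀ y ∈ S.cell (S.seq w) k, S.len k ≤ ‖y - u‖) {y : EuclideanSpace ℝ (Fin d)}
    (hy : y ∈ S.cell (S.seq w') n) : S.len k ≤ ‖y - u‖ := by
  by_cases h : Agree (S.digits n) k w w'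
  · refine ha y ?_
    rw [S.cell_congr (a := S.seq w) (b := S.seq w') h]
    exact (S.valid_seq w').cell_subset hkn hy
  · obtain ⟨j, hj, h1, h2⟩ := exists_branch h
    have h3 := hu.mul_norm_digits_sub_le hj hkn h1 hy
    have h4 := DigitTree.one_le_norm_sub h2
    have h5 := S.gap_pos j
    have h6 := S.len_succ_le_gap' j
    have h7 := S.len_antitone (Nat.succ_le_of_lt hj)
    have h8 := S.len_pos k
    rw [Nat.succ_eq_add_one] at h7
    nlinarith

lemma IsNear.norm_sum_cellField_le [IsFiniteMeasure ν] (hν : ν S.cantorSetᶜ = 0)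
    (hu : S.IsNear w k u) (hkn : k ≤ n) (ha : ∀ y ∈ S.cell (S.seq w) k, S.len k ≤ ‖y - u‖)
    (hb : ‖rieszTransform d s ν u‖ ≤ 1) : ‖∑ w', S.cellField ν n u w'‖ ≤ 1 := by
  have hi : ∀ w' : S.Word n,
      IntegrableOn (fun y => rieszKernel d s (y - u)) (S.cell (S.seq w') n) ν := fun w' =>
    integrableOn_rieszKernel (S.len_pos k) S.isClosed_cell.measurableSet S.exp_pos
      fun y hy => hu.len_le_norm_sub hkn ha hy
  have h := integral_iUnion_fintype (fun w' => S.isClosed_cell.measurableSet)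
    (S.pairwise_disjoint_cell n) hi
  rw [Measure.restrict_eq_self_of_ae_mem (ae_mem_iUnion_cell hν n)] at h
  refine (congrArg norm h.symm).trans_le (norm_integral_rieszKernel_le (S.len_pos k) ?_ hb)
  filter_upwards [ae_mem_iUnion_cell hν n] with y hy
  obtain ⟨w', hw'⟩ := mem_iUnion.1 hy
  rw [dist_eq_norm]
  exact hu.len_le_norm_sub hkn ha hw'

lemma IsNear.norm_near_sub_field_le [IsFiniteMeasure ν] (hν : ν S.cantorSetᶜ = 0)
    (hu : S.IsNear w k u) (hkn : k ≤ n) (ha : ∀ y ∈ S.cell (S.seq w) k, S.len k ≤ ‖y - u‖)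
    (hb : ‖rieszTransform d s ν u‖ ≤ 1) {T : ℝ} (hT : 0 ≤ T)
    (hM : ∀ i ≤ k, ∀ v, classMass (S.digits n) (S.cellMass ν n) i v ≤ T * S.len i ^ s) :
    ‖∑ w', agreeInd (S.digits n) k w w' • S.cellField ν n u w' -
      ∑ j ∈ Finset.range k, (S.tree n).field (S.cellMass ν n) j w‖ ≤ 1 + S.farConst * T := by
  have h1 := hu.norm_sum_cellField_le hν hkn ha hb
  have h2 := hu.norm_sum_branch_add_field_le hkn hT hM
  rw [sum_eq_agree_add_branch (S.digits n) k w] at h1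
  have h3 := (_root_.norm_sub_le _ _).trans (add_le_add h1 h2)
  refine le_trans (le_of_eq (congrArg norm ?_)) h3
  abel

/-- The lower bound for a coordinate of the kernel on a cube. -/
def nearConst (d : ℕ) (s : ℝ) : ℝ := (4 * d : ℝ) ^ (-(s + 1))

lemma nearConst_pos (S : Scales d s) : 0 < nearConst d s := by
  have := S.one_le_dim'
  unfold nearConst
  positivity

lemma IsNear.classMass_le_near [IsFiniteMeasure ν] (hu : S.IsNear w k u) (hkn : k ≤ n)
    {i₀ : Fin d} {σ : ℝ} (ha : ∀ y ∈ S.cell (S.seq w) k, S.len k ≤ ‖y - u‖)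
    (hσ : ∀ y ∈ S.cell (S.seq w) k, S.len k ≤ σ * (y i₀ - u i₀)) :
    nearConst d s * (S.len k ^ (-s) * classMass (S.digits n) (S.cellMass ν n) k w) ≤
      σ * (∑ w', agreeInd (S.digits n) k w w' • S.cellField ν n u w') i₀ := by
  have hl := S.len_pos k
  have hd := S.one_le_dim'
  rw [WithLp.ofLp_sum, Finset.sum_apply, Finset.mul_sum, classMass, Finset.mul_sum, Finset.mul_sum]
  refine Finset.sum_le_sum fun w' _ => ?_
  by_cases h : Agree (S.digits n) k w w'
  · rw [agreeInd_of h, one_smul, one_mul]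
    have hm : MeasurableSet (S.cell (S.seq w') n) := S.isClosed_cell.measurableSet
    have hi : IntegrableOn (fun y => rieszKernel d s (y - u)) (S.cell (S.seq w') n) ν :=
      integrableOn_rieszKernel hl hm S.exp_pos fun y hy => hu.len_le_norm_sub hkn ha hy
    have h1 : σ * S.cellField ν n u w' i₀ =
        ∫ y in S.cell (S.seq w') n, σ * rieszKernel d s (y - u) i₀ ∂ν := by
      rw [integral_const_mul]
      congr 1
      exact ((EuclideanSpace.proj (𝕜 := ℝ) i₀).integral_comp_comm hi).symm
    have hi' : IntegrableOn (fun y => σ * rieszKernel d s (y - u) i₀) (S.cell (S.seq w') n) ν :=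
      ((EuclideanSpace.proj (𝕜 := ℝ) i₀).integrable_comp hi).const_mul σ
    have h2 : nearConst d s * (S.len k ^ (-s) * S.cellMass ν n w') =
        ∫ _y in S.cell (S.seq w') n, nearConst d s * S.len k ^ (-s) ∂ν := by
      rw [setIntegral_const, smul_eq_mul, cellMass]
      ring
    rw [h1, h2]
    refine setIntegral_mono_on integrableOn_const hi' hm fun y hy => ?_
    have hy' : y ∈ S.cell (S.seq w) k := by
      rw [S.cell_congr (a := S.seq w) (b := S.seq w') h]
      exact (S.valid_seq w').cell_subset hkn hy
    have h3 : ‖y - u‖ ≤ d * (4 * S.len k) := by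
      refine EuclideanSpace.norm_le_mul_of_forall_abs_le (by positivity) fun i => ?_
      have h4 := abs_le.1 (S.abs_sub_corner_le hy' i)
      have h5 := abs_le.1 (hu i)
      rw [PiLp.sub_apply, abs_le]
      constructor <;> linarith
    have h4 := hσ y hy'
    have h5 : 0 < ‖y - u‖ := hl.trans_le (ha y hy')
    have h6 : (d * (4 * S.len k)) ^ (-(s + 1)) ≤ ‖y - u‖ ^ (-(s + 1)) :=
      Real.rpow_le_rpow_of_nonpos h5 h3 (by linarith [S.exp_pos])
    have h7 : (d * (4 * S.len k)) ^ (-(s + 1)) * S.len k = nearConst d s * S.len k ^ (-s) := by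
      rw [nearConst, show (d : ℝ) * (4 * S.len k) = (4 * d) * S.len k by ring,
        Real.mul_rpow (by positivity) hl.le, mul_assoc, ← Real.rpow_add_one hl.ne']
      congr 2
      ring
    rw [← h7]
    have h8 : σ * rieszKernel d s (y - u) i₀ = ‖y - u‖ ^ (-(s + 1)) * (σ * (y i₀ - u i₀)) := by
      rw [rieszKernel, PiLp.smul_apply, PiLp.sub_apply, smul_eq_mul]
      ring
    rw [h8]
    gcongr
  · rw [agreeInd_of_not h]
    simp

lemma exists_isNear (hae : ∀ᵐ x, ‖rieszTransform d s ν x‖ ≤ 1) (w : S.Word n) (k : ℕ)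
    (i₀ : Fin d) {t : ℝ} (ht : |t| ≤ 5 / 2 * S.len k) :
    ∃ u, S.IsNear w k u ∧ |u i₀ - S.corner (S.seq w) k i₀ - t| ≤ 1 / 4 * S.len k ∧
      ‖rieszTransform d s ν u‖ ≤ 1 := by
  have hl := S.len_pos k
  set c := S.corner (S.seq w) k + EuclideanSpace.single i₀ t
  obtain ⟨u, hu, hu'⟩ := (Measure.dense_of_ae hae).exists_mem_open
    (isOpen_ball (x := c) (ε := 1 / 4 * S.len k)) ⟨c, mem_ball_self (by positivity)⟩
  have h1 : ∀ i, |u i - (S.corner (S.seq w) k i + EuclideanSpace.single i₀ t i)| ≤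
      1 / 4 * S.len k := fun i => by
    have h2 := EuclideanSpace.abs_apply_le_norm (u - c) i
    rw [← dist_eq_norm] at h2
    exact h2.trans (mem_ball.1 hu').le
  refine ⟨u, fun i => ?_, ?_, hu⟩
  · have h2 := abs_le.1 (h1 i)
    have h3 := abs_le.1 ht
    rw [abs_le]
    by_cases hi : i = i₀
    · subst hi
      rw [PiLp.single_apply, if_pos rfl] at h2
      constructor <;> linarith
    · rw [PiLp.single_apply, if_neg hi] at h2
      constructor <;> linarith
  · have h2 := h1 i₀
    rwa [PiLp.single_apply, if_pos rfl, ← sub_sub] at h2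

/-- The smallness conditions on the ratio of the construction. -/
structure Small (S : Scales d s) : Prop where
  far : S.farConst ≤ nearConst d s / 2
  ratio_rpow : S.ratio ^ (2 * s) ≤ 1 / 4
  eta : (s + 2) * d * S.eta * (2 * (144 * (d : ℝ) ^ (2 * s)) + 1) ≤ 1 / 4

lemma exists_isNear_left (hae : ∀ᵐ x, ‖rieszTransform d s ν x‖ ≤ 1) (w : S.Word n) (k : ℕ)
    (i₀ : Fin d) : ∃ u, S.IsNear w k u ∧
      (∀ y ∈ S.cell (S.seq w) k, S.len k ≤ 1 * (y i₀ - u i₀)) ∧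
      (∀ y ∈ S.cell (S.seq w) k, S.len k ≤ ‖y - u‖) ∧ ‖rieszTransform d s ν u‖ ≤ 1 := by
  have hl := S.len_pos k
  obtain ⟨u, h1, h2, h3⟩ := exists_isNear hae w k i₀ (t := -(2 * S.len k))
    (by rw [abs_neg, abs_of_pos (by positivity)]; linarith)
  have h4 : ∀ y ∈ S.cell (S.seq w) k, S.len k ≤ 1 * (y i₀ - u i₀) := fun y hy => by
    have := abs_le.1 h2
    have := (hy i₀).1
    linarith
  refine ⟨u, h1, h4, fun y hy => (h4 y hy).trans ?_, h3⟩
  rw [one_mul]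
  exact (le_abs_self _).trans (EuclideanSpace.abs_apply_le_norm (y - u) i₀)

lemma exists_isNear_right (hae : ∀ᵐ x, ‖rieszTransform d s ν x‖ ≤ 1) (w : S.Word n) (k : ℕ)
    (i₀ : Fin d) : ∃ u, S.IsNear w k u ∧
      (∀ y ∈ S.cell (S.seq w) k, S.len k ≤ -1 * (y i₀ - u i₀)) ∧
      (∀ y ∈ S.cell (S.seq w) k, S.len k ≤ ‖y - u‖) ∧ ‖rieszTransform d s ν u‖ ≤ 1 := by
  have hl := S.len_pos k
  obtain ⟨u, h1, h2, h3⟩ := exists_isNear hae w k i₀ (t := 5 / 2 * S.len k)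
    (by rw [abs_of_pos (by positivity)])
  have h4 : ∀ y ∈ S.cell (S.seq w) k, S.len k ≤ -1 * (y i₀ - u i₀) := fun y hy => by
    have := abs_le.1 h2
    have := (hy i₀).2
    linarith
  refine ⟨u, h1, h4, fun y hy => (h4 y hy).trans ?_, h3⟩
  rw [neg_one_mul]
  exact (neg_le_abs _).trans (EuclideanSpace.abs_apply_le_norm (y - u) i₀)

theorem classMass_le [IsFiniteMeasure ν] (hS : S.Small) (hν : ν S.cantorSetᶜ = 0)
    (hae : ∀ᵐ x, ‖rieszTransform d s ν x‖ ≤ 1) (n k : ℕ) (hkn : k ≤ n) (w : S.Word n) :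
    classMass (S.digits n) (S.cellMass ν n) k w ≤ 2 / nearConst d s * S.len k ^ s := by
  induction k using Nat.strong_induction_on generalizing w with
  | _ k ih =>
  have : Nonempty (S.Word n) := ⟨w⟩
  obtain ⟨v, hv⟩ := Finite.exists_max (classMass (S.digits n) (S.cellMass ν n) k)
  refine (hv w).trans ?_
  have hl := S.len_pos k
  have hc := S.nearConst_pos
  have hls : 0 < S.len k ^ s := Real.rpow_pos_of_pos hl s
  set M := S.len k ^ (-s) * classMass (S.digits n) (S.cellMass ν n) k v with hMdef
  have hM0 : M * S.len k ^ s = classMass (S.digits n) (S.cellMass ν n) k v := by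
    rw [hMdef, Real.rpow_neg hl.le]
    field_simp
  rw [← hM0]
  refine mul_le_mul_of_nonneg_right ?_ hls.le
  by_contra! hlt
  have hMpos : 0 < M := (by positivity : 0 < 2 / nearConst d s).trans hlt
  have hM : ∀ i ≤ k, ∀ v', classMass (S.digits n) (S.cellMass ν n) i v' ≤ M * S.len i ^ s := by
    intro i hi v'
    rcases hi.lt_or_eq with h | rfl
    · refine (ih i h (h.le.trans hkn) v').trans ?_
      have := S.len_pos i
      gcongr
    · rw [hM0]
      exact hv v'
  let i₀ : Fin d := ⟨0, S.one_le_dim⟩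
  obtain ⟨u, hu, hσ, ha, hb⟩ := exists_isNear_left hae v k i₀
  obtain ⟨u', hu', hσ', ha', hb'⟩ := exists_isNear_right hae v k i₀
  have h1 := hu.classMass_le_near (ν := ν) hkn ha hσ
  have h2 := hu'.classMass_le_near (ν := ν) hkn ha' hσ'
  have h3 := (EuclideanSpace.abs_apply_le_norm _ i₀).trans
    (hu.norm_near_sub_field_le hν hkn ha hb hMpos.le hM)
  have h4 := (EuclideanSpace.abs_apply_le_norm _ i₀).trans
    (hu'.norm_near_sub_field_le hν hkn ha' hb' hMpos.le hM)
  rw [PiLp.sub_apply, abs_le] at h3 h4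
  have h5 : S.farConst * M ≤ nearConst d s / 2 * M := by
    have := hS.far
    gcongr
  have h6 : nearConst d s * M ≤ 2 := by linarith [h3.1, h3.2, h4.1, h4.2]
  rw [div_lt_iff₀ hc] at hlt
  linarith

/-- The bound for the Riesz transform of a measure along the digit tree. -/
def fieldConst (d : ℕ) (s : ℝ) : ℝ := 2 + 2 / nearConst d s

theorem norm_sum_field_le [IsFiniteMeasure ν] (hS : S.Small) (hν : ν S.cantorSetᶜ = 0)
    (hae : ∀ᵐ x, ‖rieszTransform d s ν x‖ ≤ 1) (w : S.Word n) :
    ‖∑ j ∈ Finset.range n, (S.tree n).field (S.cellMass ν n) j w‖ ≤ fieldConst d s := by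
  have hl := S.len_pos n
  have hc := S.nearConst_pos
  obtain ⟨u, hu, -, ha, hb⟩ := exists_isNear_left hae w n ⟨0, S.one_le_dim⟩
  have h1 := hu.norm_near_sub_field_le hν le_rfl ha hb (T := 2 / nearConst d s) (by positivity)
    fun i hi v => classMass_le hS hν hae n i hi v
  have h2 : ‖∑ w', agreeInd (S.digits n) n w w' • S.cellField ν n u w'‖ ≤ 2 / nearConst d s := by
    have h3 := classMass_le hS hν hae n n le_rfl w
    calc _ ≤ ∑ w', S.len n ^ (-s) * (agreeInd (S.digits n) n w w' * S.cellMass ν n w') := by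
          refine (norm_sum_le _ _).trans (Finset.sum_le_sum fun w' _ => ?_)
          rw [norm_smul, Real.norm_of_nonneg agreeInd_nonneg, mul_left_comm]
          refine mul_le_mul_of_nonneg_left ?_ agreeInd_nonneg
          exact norm_setIntegral_le_of_norm_le_const (measure_lt_top _ _) fun y hy =>
            norm_rieszKernel_le S.exp_pos hl (hu.len_le_norm_sub le_rfl ha hy)
      _ = S.len n ^ (-s) * classMass (S.digits n) (S.cellMass ν n) n w := by
          rw [← Finset.mul_sum]
          rfl
      _ ≤ S.len n ^ (-s) * (2 / nearConst d s * S.len n ^ s) := by gcongr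
      _ = 2 / nearConst d s := by
          rw [Real.rpow_neg hl.le]
          have := (Real.rpow_pos_of_pos hl s).ne'
          field_simp
  have h3 : S.farConst * (2 / nearConst d s) ≤ 1 := by
    calc S.farConst * (2 / nearConst d s) ≤ nearConst d s / 2 * (2 / nearConst d s) := by
          have := hS.far
          gcongr
      _ = 1 := by field_simp
  have h4 := _root_.norm_sub_le
    (∑ w', agreeInd (S.digits n) n w w' • S.cellField ν n u w')
    (∑ w', agreeInd (S.digits n) n w w' • S.cellField ν n u w' -
      ∑ j ∈ Finset.range n, (S.tree n).field (S.cellMass ν n) j w)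
  rw [sub_sub_cancel] at h4
  rw [fieldConst]
  linarith

/-- The constant in the bound for the cube sums. -/
def cubeConst (d : ℕ) (s : ℝ) : ℝ :=
  (4 * (144 * (d : ℝ) ^ (2 * s)) + 1) * (fieldConst d s ^ 2 + (2 / nearConst d s) ^ 2)

theorem sum_cubeSum_le [IsFiniteMeasure ν] (hS : S.Small) (hν : ν S.cantorSetᶜ = 0)
    (hae : ∀ᵐ x, ‖rieszTransform d s ν x‖ ≤ 1) (n : ℕ) :
    ∑ j ∈ Finset.range n, S.len j ^ (-(2 * s)) * (S.tree n).cubeSum (S.cellMass ν n) j ≤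
      cubeConst d s * ν.real univ := by
  have hl := S.len_pos n
  have hp : ∀ w, 0 ≤ S.cellMass ν n w := fun w => S.cellMass_nonneg w
  have h := (S.tree n).sum_cubeSum_le (p := S.cellMass ν n) S.exp_pos hp S.eta_pos
    S.gap_rpow_mul_le hS.eta S.ratio_pos S.ratio_le_half hS.ratio_rpow S.len_succ_le_len n
  refine h.trans ?_
  rw [cubeConst, mul_assoc]
  have h0 : 0 ≤ 4 * (144 * (d : ℝ) ^ (2 * s)) + 1 := by positivity
  refine mul_le_mul_of_nonneg_left ?_ h0
  rw [add_mul, ← sum_cellMass hν n, Finset.mul_sum, Finset.mul_sum]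
  refine add_le_add (Finset.sum_le_sum fun w _ => ?_) ?_
  · rw [mul_comm]
    have := norm_sum_field_le hS hν hae w
    have := hp w
    gcongr
  · rw [DigitTree.cubeSum, Finset.mul_sum]
    refine Finset.sum_le_sum fun w _ => ?_
    have h1 := classMass_le hS hν hae n n le_rfl w
    have h2 := hp w
    have h3 : 0 ≤ classMass (S.digits n) (S.cellMass ν n) n w := classMass_nonneg hp
    have h4 : S.len n ^ (-(2 * s)) * (S.len n ^ s) ^ 2 = 1 := by
      rw [← Real.rpow_natCast, ← Real.rpow_mul hl.le, ← Real.rpow_add hl]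
      norm_num
      ring_nf
      exact Real.rpow_zero _
    calc S.len n ^ (-(2 * s)) *
          (S.cellMass ν n w * classMass (S.digits n) (S.cellMass ν n) n w ^ 2) ≤
          S.len n ^ (-(2 * s)) *
          (S.cellMass ν n w * (2 / nearConst d s * S.len n ^ s) ^ 2) := by gcongr
      _ = (S.len n ^ (-(2 * s)) * (S.len n ^ s) ^ 2) *
          ((2 / nearConst d s) ^ 2 * S.cellMass ν n w) := by ring
      _ = _ := by rw [h4, one_mul]

end Scales

section Tree

variable {d : ℕ} {W V : Type*} [Fintype W] [Fintype V] {dig : ℕ → W → Fin d → ℤ} {p : W → ℝ}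
  {j : ℕ}

open scoped Classical in
lemma sum_div_classMass_le_card (f : W → V) (hf : ∀ w w', f w = f w' ↔ Agree dig j w w') :
    ∑ w, p w / classMass dig p j w ≤ Fintype.card V := by
  rw [← Finset.sum_fiberwise_of_maps_to (s := Finset.univ) (t := Finset.univ) (g := f)
    fun w _ => Finset.mem_univ _, ← nsmul_one (Fintype.card V)]
  refine Finset.sum_le_card_nsmul _ _ _ fun v _ => ?_
  by_cases hv : ∃ w, f w = v
  · obtain ⟨w, rfl⟩ := hv
    have h : ∑ w' with f w' = f w, p w' / classMass dig p j w' =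
        (∑ w', agreeInd dig j w w' * p w') / classMass dig p j w := by
      rw [Finset.sum_filter, Finset.sum_div]
      refine Finset.sum_congr rfl fun w' _ => ?_
      by_cases h : Agree dig j w w'
      · rw [if_pos ((hf _ _).2 h.symm), agreeInd_of h, one_mul, classMass_congr h]
      · rw [if_neg (fun h' => h ((hf _ _).1 h').symm), agreeInd_of_not h, zero_mul, zero_div]
    rw [h]
    exact div_self_le_one _
  · rw [Finset.filter_false_of_mem fun w _ h => hv ⟨w, h⟩, Finset.sum_empty]
    exact zero_le_one

lemma pow_three_sum_le (hp : ∀ w, 0 ≤ p w) {N : ℝ}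
    (hN : ∑ w, p w / classMass dig p j w ≤ N) :
    (∑ w, p w) ^ 3 ≤ N ^ 2 * ∑ w, p w * classMass dig p j w ^ 2 := by
  set m := ∑ w, p w
  set Y := ∑ w, p w * classMass dig p j w
  set X := ∑ w, p w * classMass dig p j w ^ 2
  have hc : ∀ w, 0 ≤ classMass dig p j w := fun w => classMass_nonneg hp
  have hm : 0 ≤ m := Finset.sum_nonneg fun w _ => hp w
  have hY : 0 ≤ Y := Finset.sum_nonneg fun w _ => mul_nonneg (hp w) (hc w)
  have hX : 0 ≤ X := Finset.sum_nonneg fun w _ => mul_nonneg (hp w) (sq_nonneg _)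
  have h1 : m ^ 2 ≤ N * Y := by
    refine (Finset.sum_sq_le_sum_mul_sum_of_sq_le_mul Finset.univ
      (f := fun w => p w / classMass dig p j w) (g := fun w => p w * classMass dig p j w)
      (fun w _ => div_nonneg (hp w) (hc w)) (fun w _ => mul_nonneg (hp w) (hc w))
      fun w _ => le_of_eq ?_).trans (mul_le_mul_of_nonneg_right hN hY)
    have := div_classMass_mul (dig := dig) (j := j) (w := w) hp
    linear_combination (-(p w)) * this
  have h2 : Y ^ 2 ≤ m * X := by
    refine Finset.sum_sq_le_sum_mul_sum_of_sq_le_mul Finset.univ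
      (fun w _ => hp w) (fun w _ => mul_nonneg (hp w) (sq_nonneg _)) fun w _ => le_of_eq ?_
    ring
  rcases hm.eq_or_lt with h0 | h0
  · rw [← h0]
    simp only [ne_eq, OfNat.ofNat_ne_zero, not_false_eq_true, zero_pow]
    positivity
  · refine le_of_mul_le_mul_left ?_ h0
    calc m * m ^ 3 = (m ^ 2) ^ 2 := by ring
      _ ≤ (N * Y) ^ 2 := by gcongr
      _ = N ^ 2 * Y ^ 2 := by ring
      _ ≤ N ^ 2 * (m * X) := by gcongr
      _ = _ := by ring

end Tree

namespace Scales

variable {d : ℕ} {s : ℝ} {S : Scales d s} {j n : ℕ}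

variable (S) in
/-- The number of level `n` cubes. -/
def count (n : ℕ) : ℝ := ∏ j ∈ Finset.range n, (S.num j : ℝ) ^ d

lemma count_pos (S : Scales d s) (n : ℕ) : 0 < S.count n :=
  Finset.prod_pos fun j _ => pow_pos (S.num_pos j) d

lemma count_succ (S : Scales d s) (n : ℕ) : S.count (n + 1) = S.count n * (S.num n : ℝ) ^ d :=
  Finset.prod_range_succ _ _

lemma card_word (S : Scales d s) (n : ℕ) : (Fintype.card (S.Word n) : ℝ) = S.count n := by
  rw [count, ← Fin.prod_univ_eq_prod_range (fun j => (S.num j : ℝ) ^ d) n, Fintype.card_pi]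
  push_cast
  refine Finset.prod_congr rfl fun j _ => ?_
  simp

/-- The initial segment of a string. -/
def trunc (h : j ≤ n) (w : S.Word n) : S.Word j := fun i => w (Fin.castLE h i)

lemma trunc_eq_iff (h : j ≤ n) (w w' : S.Word n) :
    trunc h w = trunc h w' ↔ Agree (S.digits n) j w w' := by
  constructor
  · intro h1 i hi
    funext l
    have h2 : w ⟨i, hi.trans_le h⟩ l = w' ⟨i, hi.trans_le h⟩ l :=
      congrFun (congrFun h1 ⟨i, hi⟩) l
    rw [digits, digits, dif_pos (hi.trans_le h), dif_pos (hi.trans_le h), h2]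
  · intro h1
    funext i l
    have h2 := congrFun (h1 i i.2) l
    rw [digits, digits, dif_pos (i.2.trans_le h), dif_pos (i.2.trans_le h)] at h2
    exact Fin.ext (by exact_mod_cast h2)

theorem measureReal_univ_eq_zero {ν : Measure (EuclideanSpace ℝ (Fin d))} [IsFiniteMeasure ν]
    (hS : S.Small) (hν : ν S.cantorSetᶜ = 0) (hae : ∀ᵐ x, ‖rieszTransform d s ν x‖ ≤ 1)
    (hdiv : ∀ M, ∃ n, M < ∑ j ∈ Finset.range n, S.len j ^ (-(2 * s)) / S.count j ^ 2) :
    ν.real univ = 0 := by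
  by_contra hne
  have hm : 0 < ν.real univ := lt_of_le_of_ne measureReal_nonneg (Ne.symm hne)
  obtain ⟨n, hn⟩ := hdiv (cubeConst d s / ν.real univ ^ 2)
  have h1 := sum_cubeSum_le hS hν hae n
  have h2 : ν.real univ ^ 3 * ∑ j ∈ Finset.range n, S.len j ^ (-(2 * s)) / S.count j ^ 2 ≤
      cubeConst d s * ν.real univ := by
    refine le_trans ?_ h1
    rw [Finset.mul_sum]
    refine Finset.sum_le_sum fun j hj => ?_
    have h3 := pow_three_sum_le (dig := S.digits n) (j := j)
      (fun w => S.cellMass_nonneg (ν := ν) w)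
      (sum_div_classMass_le_card _ (trunc_eq_iff (Finset.mem_range.1 hj).le))
    rw [sum_cellMass hν n, S.card_word] at h3
    have h4 := S.count_pos j
    have h5 := S.len_pos j
    rw [mul_div_assoc', div_le_iff₀ (by positivity)]
    calc _ ≤ (S.count j ^ 2 * (S.tree n).cubeSum (S.cellMass ν n) j) *
          S.len j ^ (-(2 * s)) := mul_le_mul_of_nonneg_right h3 (by positivity)
      _ = _ := by ring
  rw [div_lt_iff₀ (by positivity)] at hn
  nlinarith

end Scales

lemma card_filter_abs_sub_le {K : ℕ} (a : ℤ) {R : ℝ} (hR : 0 ≤ R) :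
    (((Finset.univ : Finset (Fin K)).filter
      fun z : Fin K => |((z : ℕ) : ℝ) - a| ≤ R).card : ℝ) ≤ 2 * R + 1 := by
  have h : ((Finset.univ : Finset (Fin K)).filter fun z : Fin K => |((z : ℕ) : ℝ) - a| ≤ R).card ≤
      (Finset.Icc (a - ⌊R⌋) (a + ⌊R⌋)).card := by
    refine Finset.card_le_card_of_injOn (fun z : Fin K => ((z : ℕ) : ℤ)) (fun z hz => ?_) ?_
    · have h1 := abs_le.1 (Finset.mem_filter.1 hz).2
      have h2 : ((z : ℕ) : ℤ) - a ≤ ⌊R⌋ := Int.le_floor.2 (by push_cast; linarith)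
      have h3 : a - ((z : ℕ) : ℤ) ≤ ⌊R⌋ := Int.le_floor.2 (by push_cast; linarith)
      rw [Finset.coe_Icc]
      constructor <;> linarith
    · intro z _ z' _ hzz
      exact Fin.ext (Nat.cast_injective (R := ℤ) hzz)
  have h0 : 0 ≤ ⌊R⌋ := Int.floor_nonneg.2 hR
  have h1 : ((Finset.Icc (a - ⌊R⌋) (a + ⌊R⌋)).card : ℤ) = 2 * ⌊R⌋ + 1 := by
    rw [Int.card_Icc, Int.toNat_of_nonneg (by linarith)]
    ring
  have h2 : ((Finset.Icc (a - ⌊R⌋) (a + ⌊R⌋)).card : ℝ) = 2 * ⌊R⌋ + 1 := by exact_mod_cast h1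
  have h3 := Int.floor_le R
  calc _ ≤ ((Finset.Icc (a - ⌊R⌋) (a + ⌊R⌋)).card : ℝ) := by exact_mod_cast h
    _ ≤ _ := by rw [h2]; linarith

namespace Scales

variable {d : ℕ} {s : ℝ} {S : Scales d s} {k n : ℕ}

lemma prod_range_eq_count (S : Scales d s) (hk : k < n) (A : ℝ) :
    (∏ j ∈ Finset.range n, if j < k then 1 else if j = k then A else (S.num j : ℝ) ^ d) *
      S.count (k + 1) = A * S.count n := by
  have h1 (f : ℕ → ℝ) := Finset.prod_range_mul_prod_Ico f (Nat.succ_le_of_lt hk)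
  rw [count, count, ← h1, ← h1 fun j => (S.num j : ℝ) ^ d, Nat.succ_eq_add_one,
    Finset.prod_range_succ, if_neg (lt_irrefl k), if_pos rfl,
    Finset.prod_eq_one fun j hj => if_pos (Finset.mem_range.1 hj)]
  have h2 : ∏ j ∈ Finset.Ico (k + 1) n,
      (if j < k then 1 else if j = k then A else (S.num j : ℝ) ^ d) =
      ∏ j ∈ Finset.Ico (k + 1) n, (S.num j : ℝ) ^ d := by
    refine Finset.prod_congr rfl fun j hj => ?_
    have := (Finset.mem_Ico.1 hj).1
    rw [if_neg (by omega), if_neg (by omega)]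
  rw [h2]
  ring

open scoped Classical in
/-- The strings whose corner lies in the given ball. -/
def wordsIn (S : Scales d s) (n : ℕ) (x : EuclideanSpace ℝ (Fin d)) (ρ : ℝ) :
    Finset (S.Word n) := Finset.univ.filter fun w => S.corner (S.seq w) n ∈ ball x ρ

lemma mem_wordsIn {x : EuclideanSpace ℝ (Fin d)} {ρ : ℝ} {w : S.Word n} :
    w ∈ S.wordsIn n x ρ ↔ S.corner (S.seq w) n ∈ ball x ρ := by
  classical
  simp [wordsIn]

lemma norm_corner_sub_lt {x : EuclideanSpace ℝ (Fin d)} {ρ : ℝ} {w w' : S.Word n}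
    (hw : w ∈ S.wordsIn n x ρ) (hw' : w' ∈ S.wordsIn n x ρ) :
    ‖S.corner (S.seq w) n - S.corner (S.seq w') n‖ < 2 * ρ := by
  have h1 := mem_ball.1 (mem_wordsIn.1 hw)
  have h2 := mem_ball'.1 (mem_wordsIn.1 hw')
  rw [← dist_eq_norm]
  linarith [dist_triangle (S.corner (S.seq w) n) x (S.corner (S.seq w') n)]

lemma agree_of_mem_wordsIn {x : EuclideanSpace ℝ (Fin d)} {ρ : ℝ} {w w' : S.Word n}
    (hρ : ρ < S.len k) (hw : w ∈ S.wordsIn n x ρ) (hw' : w' ∈ S.wordsIn n x ρ) :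
    Agree (S.digits n) k w w' := by
  by_contra h
  obtain ⟨j, hj, h1, h2⟩ := exists_branch h
  have h3 : S.gap j / 2 * ‖S.digits n j w - S.digits n j w'‖ ≤
    ‖S.corner (S.seq w) n - S.corner (S.seq w') n‖ := (S.tree n).le_norm j w w' h1
  have h4 := norm_corner_sub_lt hw hw'
  have h5 := DigitTree.one_le_norm_sub h2
  have h6 := S.len_antitone (Nat.succ_le_of_lt hj)
  have h7 := S.len_succ_le_gap' j
  have h8 := S.gap_pos j
  rw [Nat.succ_eq_add_one] at h6
  nlinarith

lemma card_wordsIn_mul_count_le (x : EuclideanSpace ℝ (Fin d)) {ρ : ℝ} (hρ0 : 0 ≤ ρ)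
    (hρ : ρ < S.len k) (hk : k < n) :
    ((S.wordsIn n x ρ).card : ℝ) * S.count (k + 1) ≤ (8 * ρ / S.gap k + 1) ^ d * S.count n := by
  have hg := S.gap_pos k
  rcases (S.wordsIn n x ρ).eq_empty_or_nonempty with he | ⟨w₀, hw₀⟩
  · rw [he, Finset.card_empty, Nat.cast_zero, zero_mul]
    have := S.count_pos n
    positivity
  rw [← S.prod_range_eq_count hk]
  refine mul_le_mul_of_nonneg_right ?_ (S.count_pos _).le
  let B (j : Fin n) (i : Fin d) : Finset (Fin (S.num j)) :=
    if (j : ℕ) < k then {w₀ j i}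
    else if (j : ℕ) = k then
      Finset.univ.filter fun z => |((z : ℕ) : ℝ) - S.digits n k w₀ i| ≤ 4 * ρ / S.gap k
    else Finset.univ
  have hsub : S.wordsIn n x ρ ⊆
      Fintype.piFinset fun j : Fin n => Fintype.piFinset fun i => B j i := by
    intro w hw
    have hag := agree_of_mem_wordsIn hρ hw₀ hw
    refine Fintype.mem_piFinset.2 fun j => Fintype.mem_piFinset.2 fun i => ?_
    simp only [B]
    split_ifs with h1 h2
    · have h3 := congrFun (hag j h1) i
      rw [digits, digits, dif_pos j.2, dif_pos j.2] at h3
      exact Finset.mem_singleton.2 (Fin.ext (by exact_mod_cast h3.symm))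
    · refine Finset.mem_filter.2 ⟨Finset.mem_univ _, ?_⟩
      have h3 : S.gap k / 2 * ‖S.digits n k w - S.digits n k w₀‖ ≤
        ‖S.corner (S.seq w) n - S.corner (S.seq w₀) n‖ := (S.tree n).le_norm k w w₀ hag.symm
      have h4 := norm_corner_sub_lt hw hw₀
      have h5 := norm_le_pi_norm (S.digits n k w - S.digits n k w₀) i
      rw [Pi.sub_apply, Int.norm_eq_abs, Int.cast_sub] at h5
      have h6 : (S.digits n k w i : ℝ) = ((w j i : ℕ) : ℝ) := by
        subst h2
        rw [digits, dif_pos j.2]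
        simp
      rw [h6] at h5
      rw [le_div_iff₀ hg]
      nlinarith
    · exact Finset.mem_univ _
  calc ((S.wordsIn n x ρ).card : ℝ) ≤
        (Fintype.piFinset fun j : Fin n => Fintype.piFinset fun i => B j i).card := by
        exact_mod_cast Finset.card_le_card hsub
    _ = ∏ j : Fin n, ∏ i, ((B j i).card : ℝ) := by
        rw [Fintype.card_piFinset]
        push_cast
        refine Finset.prod_congr rfl fun j _ => ?_
        rw [Fintype.card_piFinset]
        push_cast
        rfl
    _ ≤ ∏ j : Fin n, (fun j : ℕ => if j < k then 1 else if j = k then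
          (8 * ρ / S.gap k + 1) ^ d else (S.num j : ℝ) ^ d) j := by
        refine Finset.prod_le_prod (fun j _ => by positivity) fun j _ => ?_
        simp only [B]
        split_ifs with h1 h2
        · simp
        · refine (Finset.prod_le_prod (fun _ _ => by positivity) fun i _ =>
            card_filter_abs_sub_le _ (by positivity)).trans (le_of_eq ?_)
          rw [Finset.prod_const, Finset.card_univ, Fintype.card_fin]
          congr 2
          ring
        · simp
    _ = _ := Fin.prod_univ_eq_prod_range (fun j : ℕ => if j < k then 1 else if j = k then
          (8 * ρ / S.gap k + 1) ^ d else (S.num j : ℝ) ^ d) n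

variable {h : ℝ → ℝ}

lemma count_mul_gauge (hh : ∀ j, (S.num j : ℝ) ^ d * h (S.len (j + 1)) = h (S.len j)) (n : ℕ) :
    S.count n * h (S.len n) = h (S.len 0) := by
  induction n with
  | zero => simp [count]
  | succ n ih => rw [S.count_succ, mul_assoc, hh, ih]

lemma card_wordsIn_mul_gauge_le (hmono : StrictMonoOn h (Ici 0)) (h0 : h 0 = 0)
    (hdec : ∀ r₁ r₂ : ℝ, 0 < r₁ → r₁ ≤ r₂ → h r₂ / r₂ ^ d ≤ h r₁ / r₁ ^ d)
    (hh : ∀ j, (S.num j : ℝ) ^ d * h (S.len (j + 1)) = h (S.len j))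
    (x : EuclideanSpace ℝ (Fin d)) {ρ : ℝ} (hρ : S.len n ≤ ρ) :
    (S.wordsIn n x ρ).card * h (S.len 0) ≤ 9 ^ d * S.count n * h ρ := by
  have hρ0 : 0 < ρ := (S.len_pos n).trans_le hρ
  have hn := S.count_pos n
  have hhρ := gaugeFun_nonneg hmono h0 hρ0.le
  by_cases h1 : S.len 0 ≤ ρ
  · have h2 : ((S.wordsIn n x ρ).card : ℝ) ≤ S.count n := by
      rw [← S.card_word]
      exact_mod_cast Finset.card_le_univ _
    have h3 : h (S.len 0) ≤ h ρ := hmono.monotoneOn (S.len_pos 0).le hρ0.le h1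
    have h4 : (1 : ℝ) ≤ 9 ^ d := one_le_pow₀ (by norm_num)
    have h5 := gaugeFun_nonneg hmono h0 (S.len_pos 0).le
    calc _ ≤ S.count n * h ρ := by gcongr
      _ = 1 * (S.count n * h ρ) := (one_mul _).symm
      _ ≤ 9 ^ d * (S.count n * h ρ) := by gcongr
      _ = _ := by ring
  · obtain ⟨k, hk, hk1, hk2⟩ : ∃ k < n, S.len (k + 1) ≤ ρ ∧ ρ < S.len k := by
      classical
      have hex : ∃ k, S.len k ≤ ρ := ⟨n, hρ⟩
      have hpos : Nat.find hex ≠ 0 := fun h2 => h1 (h2 ▸ Nat.find_spec hex)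
      obtain ⟨k, hk⟩ := Nat.exists_eq_succ_of_ne_zero hpos
      have h2 := Nat.find_min' hex hρ
      refine ⟨k, by omega, ?_, not_le.1 (Nat.find_min hex (by omega))⟩
      have := Nat.find_spec hex
      rwa [hk] at this
    have hg := S.gap_pos k
    have hK := S.num_pos k
    have hl := S.len_pos k
    have h2 := card_wordsIn_mul_count_le x hρ0.le hk2 hk
    have h3 := gaugeFun_nonneg hmono h0 (S.len_pos (k + 1)).le
    have h4 : (8 * ρ / S.gap k + 1) ^ d * h (S.len (k + 1)) ≤ 9 ^ d * h ρ := by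
      rcases le_total ρ (S.gap k) with h5 | h5
      · have h6 : 8 * ρ / S.gap k + 1 ≤ 9 := by
          have : 8 * ρ / S.gap k ≤ 8 := by rw [div_le_iff₀ hg]; linarith
          linarith
        have h7 : h (S.len (k + 1)) ≤ h ρ := hmono.monotoneOn (S.len_pos _).le hρ0.le hk1
        gcongr
      · have h6 : 8 * ρ / S.gap k + 1 ≤ 9 * (ρ / S.gap k) := by
          have h7 : 1 ≤ ρ / S.gap k := by rwa [le_div_iff₀ hg, one_mul]
          rw [mul_div_assoc]
          linarith
        have h7 := hdec ρ (S.len k) hρ0 hk2.le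
        calc (8 * ρ / S.gap k + 1) ^ d * h (S.len (k + 1)) ≤
              (9 * (ρ / S.gap k)) ^ d * h (S.len (k + 1)) := by gcongr
          _ = 9 ^ d * (ρ ^ d * (h (S.len k) / S.len k ^ d)) := by
              rw [← hh k, ← S.gap_mul_num k, mul_pow, mul_pow, div_pow]
              field_simp
          _ ≤ 9 ^ d * (ρ ^ d * (h ρ / ρ ^ d)) := by gcongr
          _ = 9 ^ d * h ρ := by field_simp
    calc (S.wordsIn n x ρ).card * h (S.len 0) =
          (S.wordsIn n x ρ).card * S.count (k + 1) * h (S.len (k + 1)) := by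
          rw [← count_mul_gauge hh (k + 1)]; ring
      _ ≤ (8 * ρ / S.gap k + 1) ^ d * S.count n * h (S.len (k + 1)) := by gcongr
      _ = S.count n * ((8 * ρ / S.gap k + 1) ^ d * h (S.len (k + 1))) := by ring
      _ ≤ S.count n * (9 ^ d * h ρ) := by gcongr
      _ = _ := by ring

theorem hContent_cantorSet_ne_zero (hmono : StrictMonoOn h (Ici 0)) (h0 : h 0 = 0)
    (hdec : ∀ r₁ r₂ : ℝ, 0 < r₁ → r₁ ≤ r₂ → h r₂ / r₂ ^ d ≤ h r₁ / r₁ ^ d)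
    (hh : ∀ j, (S.num j : ℝ) ^ d * h (S.len (j + 1)) = h (S.len j)) :
    hContent d h S.cantorSet ≠ 0 := by
  have hpos := gaugeFun_pos hmono h0 (S.len_pos 0)
  have hc : 0 < h (S.len 0) / 18 ^ d := by positivity
  refine (lt_of_lt_of_le (ENNReal.ofReal_pos.2 hc) ?_).ne'
  refine le_iInf fun x => le_iInf fun r => le_iInf fun hr => le_iInf fun hE => ?_
  obtain ⟨t, ht⟩ := S.isCompact_cantorSet.elim_finite_subcover
    (fun j => ball (x j) (2 * r j)) (fun j => isOpen_ball) (hE.trans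
      (iUnion_mono fun j => closedBall_subset_ball (by linarith [hr j])))
  obtain ⟨n, hn⟩ : ∃ n, ∀ j ∈ t, S.len n ≤ 2 * r j := by
    refine (((Finset.eventually_all t).2 fun j _ => ?_) : ∀ᶠ n in atTop, _).exists
    exact S.tendsto_len.eventually (ge_mem_nhds (by linarith [hr j]))
  have hcard : S.count n ≤ ∑ j ∈ t, ((S.wordsIn n (x j) (2 * r j)).card : ℝ) := by
    classical
    have hsub : (Finset.univ : Finset (S.Word n)) ⊆
        t.biUnion fun j => S.wordsIn n (x j) (2 * r j) := by
      intro w _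
      obtain ⟨j, hj, hw⟩ := mem_iUnion₂.1 (ht (S.corner_mem_cantorSet w))
      exact Finset.mem_biUnion.2 ⟨j, hj, mem_wordsIn.2 hw⟩
    rw [← S.card_word]
    exact_mod_cast (Finset.card_le_card hsub).trans Finset.card_biUnion_le
  have hdouble : ∀ j, h (2 * r j) ≤ 2 ^ d * h (r j) := fun j => by
    have h1 := hr j
    have h2 := hdec (r j) (2 * r j) h1 (by linarith)
    rw [div_le_div_iff₀ (by positivity) (by positivity), mul_pow] at h2
    have h3 : 0 < r j ^ d := by positivity
    refine le_of_mul_le_mul_right (h2.trans (le_of_eq ?_)) h3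
    ring
  have hn0 := S.count_pos n
  have hsum : h (S.len 0) / 18 ^ d ≤ ∑ j ∈ t, h (r j) := by
    rw [div_le_iff₀ (by positivity)]
    refine le_of_mul_le_mul_left ?_ hn0
    calc S.count n * h (S.len 0) ≤
          ∑ j ∈ t, ((S.wordsIn n (x j) (2 * r j)).card : ℝ) * h (S.len 0) := by
          rw [← Finset.sum_mul]
          gcongr
      _ ≤ ∑ j ∈ t, 9 ^ d * S.count n * (2 ^ d * h (r j)) := by
          refine Finset.sum_le_sum fun j hj =>
            (card_wordsIn_mul_gauge_le hmono h0 hdec hh _ (hn j hj)).trans ?_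
          have := hdouble j
          gcongr
      _ = S.count n * ((∑ j ∈ t, h (r j)) * 18 ^ d) := by
          rw [Finset.sum_mul, Finset.mul_sum, show (18 : ℝ) = 9 * 2 by norm_num, mul_pow]
          exact Finset.sum_congr rfl fun j _ => by ring
  calc ENNReal.ofReal (h (S.len 0) / 18 ^ d) ≤ ENNReal.ofReal (∑ j ∈ t, h (r j)) :=
        ENNReal.ofReal_le_ofReal hsum
    _ = ∑ j ∈ t, ENNReal.ofReal (h (r j)) :=
        ENNReal.ofReal_sum_of_nonneg fun j _ => gaugeFun_nonneg hmono h0 (hr j).le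
    _ ≤ _ := ENNReal.sum_le_tsum t

end Scales

lemma exists_ratio {s : ℝ} (hs : 0 < s) (A B C : ℝ)
    {b c : ℝ} (hb : 0 < b) (hc : 0 < c) : ∃ τ : ℝ, 0 < τ ∧ τ < 1 ∧ A * τ ≤ 1 ∧
      τ ^ (2 * s) ≤ 1 / 4 ∧ B * τ ^ (s + 1) ≤ b ∧ C * τ ^ (s + 1) ≤ c := by
  have h1 (p : ℝ) (hp : 0 < p) : Tendsto (fun τ : ℝ => τ ^ p) (𝓝[>] 0) (𝓝 0) := by
    have h2 := (Real.continuousAt_rpow_const 0 p (Or.inr hp.le)).tendsto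
    rw [Real.zero_rpow hp.ne'] at h2
    exact h2.mono_left nhdsWithin_le_nhds
  have h3 (A p a : ℝ) (hp : 0 < p) (ha : 0 < a) : ∀ᶠ τ : ℝ in 𝓝[>] 0, A * τ ^ p ≤ a := by
    have h4 := (h1 p hp).const_mul A
    rw [mul_zero] at h4
    exact h4.eventually (ge_mem_nhds ha)
  obtain ⟨τ, h4, h5, h6, h7, h8, h9⟩ := ((eventually_mem_nhdsWithin (a := (0 : ℝ)) (s := Ioi 0)).and
    ((h3 1 1 (1 / 2) one_pos (by norm_num)).and ((h3 A 1 1 one_pos one_pos).and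
    ((h3 1 (2 * s) (1 / 4) (by linarith) (by norm_num)).and
    ((h3 B (s + 1) b (by linarith) hb).and (h3 C (s + 1) c (by linarith) hc)))))).exists
  rw [Real.rpow_one] at h5 h6
  exact ⟨τ, h4, by linarith, h6, by linarith, h8, h9⟩

lemma rieszTransform_zero_measure (d : ℕ) (s : ℝ) (x : EuclideanSpace ℝ (Fin d)) :
    rieszExists d s 0 x ∧ rieszTransform d s 0 x = 0 := by
  have h : Tendsto (fun ε => truncRiesz d s 0 ε x) (𝓝[>] (0 : ℝ)) (𝓝 0) := by
    simp [truncRiesz]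
  exact ⟨⟨0, h⟩, h.limUnder_eq⟩

lemma gammaPlus_eq_zero {d : ℕ} {s : ℝ} {E : Set (EuclideanSpace ℝ (Fin d))}
    (hE : ∀ ν : Measure (EuclideanSpace ℝ (Fin d)), IsFiniteMeasure ν → ν Eᶜ = 0 →
      (∀ᵐ x : EuclideanSpace ℝ (Fin d), ‖rieszTransform d s ν x‖ ≤ 1) → ν.real univ = 0) :
    gammaPlus d s E = 0 := by
  rw [gammaPlus, ← csSup_singleton (0 : ℝ)]
  congr 1
  refine eq_singleton_iff_unique_mem.2 ⟨⟨0, inferInstance, by simp, ?_, by simp⟩, ?_⟩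
  · refine Eventually.of_forall fun x => ⟨(rieszTransform_zero_measure d s x).1, ?_⟩
    rw [(rieszTransform_zero_measure d s x).2, norm_zero]
    exact zero_le_one
  · rintro t ⟨ν, hν, hE', hae, rfl⟩
    exact hE ν hν hE' (hae.mono fun x hx => hx.2)

lemma Scales.exists_sum_len_rpow_gt {d : ℕ} {s : ℝ} (S : Scales d s) {h : ℝ → ℝ}
    (hmono : StrictMonoOn h (Ici 0)) (h0 : h 0 = 0)
    (hh : ∀ j, (S.num j : ℝ) ^ d * h (S.len (j + 1)) = h (S.len j))
    (hdiv : ∀ M, ∃ n, M < ∑ j ∈ Finset.range n, (h (S.len j) / S.len j ^ s) ^ 2) (M : ℝ) :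
    ∃ n, M < ∑ j ∈ Finset.range n, S.len j ^ (-(2 * s)) / S.count j ^ 2 := by
  have hpos := gaugeFun_pos hmono h0 (S.len_pos 0)
  obtain ⟨n, hn⟩ := hdiv (h (S.len 0) ^ 2 * M)
  refine ⟨n, lt_of_mul_lt_mul_left (hn.trans_le (le_of_eq ?_)) (sq_nonneg (h (S.len 0)))⟩
  rw [Finset.mul_sum]
  refine Finset.sum_congr rfl fun j _ => ?_
  have hc := S.count_pos j
  have hl := Real.rpow_pos_of_pos (S.len_pos j) s
  rw [← S.count_mul_gauge hh j, Real.rpow_neg (S.len_pos j).le, two_mul,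
    Real.rpow_add (S.len_pos j)]
  field_simp

/-- Corollary 7.5: if `h` is a gauge function with `h(r)/r^d` nonincreasing and
`∫_0 (h(t)/t^s)² dt/t = ∞`, then there is a compact set `E` with `M_h(E) > 0` but
`γ_{s,+}(E) = 0`. -/
theorem statement19 (d : ℕ) (hd : 1 ≤ d) (s : ℝ) (hs : 0 < s) (hsd : s < d)
    (h : ℝ → ℝ)
    (hcont : ContinuousOn h (Ici 0)) (hmono : StrictMonoOn h (Ici 0)) (h0 : h 0 = 0)
    (htop : Tendsto h atTop atTop)
    (hdec : ∀ r₁ r₂ : ℝ, 0 < r₁ → r₁ ≤ r₂ → h r₂ / r₂ ^ d ≤ h r₁ / r₁ ^ d)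
    (hdiv : ∃ a : ℝ, 0 < a ∧
      ¬ IntervalIntegrable (fun t => (h t / t ^ s) ^ 2 / t) volume 0 a) :
    ∃ E : Set (EuclideanSpace ℝ (Fin d)), IsCompact E ∧ hContent d h E ≠ 0 ∧
      gammaPlus d s E = 0 := by
  have hd0 : (0 : ℝ) < d := by exact_mod_cast hd
  have hZ := latticeSum_pos (d := d)
  obtain ⟨τ, hτ, hτ1, hr1, hr2, hr3, hr4⟩ := exists_ratio hs (20 * d)
    (10 * d * (s + 2) * (2 ^ (s + 1) * latticeSum d))
    ((s + 2) * d * (2 ^ (s + 1) * latticeSum d) * (2 * (144 * (d : ℝ) ^ (2 * s)) + 1))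
    (b := (4 * d : ℝ) ^ (-(s + 1)) / 2) (c := 1 / 4) (by positivity) (by norm_num)
  have hκ : (d + 1) / (s + 1) * s < d := by
    rw [div_mul_eq_mul_div, div_lt_iff₀ (by linarith)]
    linarith
  obtain ⟨ℓ, K, -, hℓ, hK, hh, hdecay, hsum⟩ := exists_scales hs hcont hmono h0 hdiv
    (by positivity) hκ hτ hτ1
  let S : Scales d s :=
    { len := ℓ, num := K, ratio := τ, one_le_dim := hd, exp_pos := hs, exp_lt := hsd,
      len_pos := hℓ, two_le_num := hK, ratio_pos := hτ, ratio_le := hr1,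
      len_succ_le := hdecay }
  have hS : S.Small :=
    { far := by
        refine le_of_eq_of_le ?_ hr3
        change 10 * d * (s + 2) * (2 ^ (s + 1) * latticeSum d * τ ^ (s + 1)) = _
        ring
      ratio_rpow := hr2
      eta := by
        refine le_of_eq_of_le ?_ hr4
        change (s + 2) * d * (2 ^ (s + 1) * latticeSum d * τ ^ (s + 1)) * _ = _
        ring }
  refine ⟨S.cantorSet, S.isCompact_cantorSet, S.hContent_cantorSet_ne_zero hmono h0 hdec hh,
    gammaPlus_eq_zero fun ν _ hν hae => ?_⟩
  exact S.measureReal_univ_eq_zero hS hν hae (S.exists_sum_len_rpow_gt hmono h0 hh hsum)
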